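/- Consider the network with adaptive state coupling only, under aperiodically intermittent pinning control of node 1: let π, w¹, …, wᴺ : [−τ̄, ∞) × Ω̄ → ℝⁿ be continuous, vanish on [−τ̄, ∞) × ∂Ω, be continuously differentiable in t on (0,∞) with jointly continuous time derivative, and twice continuously differentiable in x with jointly continuous spatial derivatives, such that: π satisfies ∂π/∂t = f(π); for t in the control spans [t_i, s_i], ∂w¹/∂t = f(w¹) + Ψ(t)∑_k ξ_{1k}Γ¹w^k + Ψ(t)σΓ¹(π − w¹), and for j = 2,…,N, ∂w^j/∂t = f(w^j) + Ψ(t)∑_k ξ_{jk}Γ¹w^k; for t in the rest spans (s_i, t_{i+1}) and all j = 1,…,N, ∂w^j/∂t = f(w^j) + ∑_k ξ_{jk}Γ¹w^k. Suppose Ψ(0) = 0, Ψ(t) = 0 on (s_i, t_{i+1}), Ψ(t_{i+1}) = Ψ(s_i), and on each [t_i, s_i], Ψ′(t) = ψ · max_{−τ̄ ≤ ς ≤ 0} ‖e(t+ς, ·)‖² with ψ > 0. If τ̄ < inf_i (s_i − t_i) and there exist 0 < θ < ω < ∞ with inf_i (s_i − t_i) = θ and sup_i (t_{i+1} − t_i)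 = ω, then lim_{t→∞} ‖e(t,·)‖ = 0. -/

import Mathlib

open MeasureTheory Set Matrix Filter

/-- The partial derivative `∂u/∂x_r` of a scalar field on `ℝ^m`. -/
noncomputable def par {m : ℕ} (u : EuclideanSpace ℝ (Fin m) → ℝ) (r : Fin m)
    (x : EuclideanSpace ℝ (Fin m)) : ℝ :=
  fderiv ℝ u x (EuclideanSpace.single r 1)

/-- The second partial derivative `∂²u/∂x_r²`. -/
noncomputable def par2 {m : ℕ} (u : EuclideanSpace ℝ (Fin m) → ℝ) (r : Fin m)
    (x : EuclideanSpace ℝ (Fin m)) : ℝ :=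
  par (par u r) r x

/-- The Laplacian `Δu = ∑_r ∂²u/∂x_r²`. -/
noncomputable def lap {m : ℕ} (u : EuclideanSpace ℝ (Fin m) → ℝ)
    (x : EuclideanSpace ℝ (Fin m)) : ℝ :=
  ∑ r, par2 u r x

/-- The `k`-th component of the uncoupled reaction-diffusion neural-network
drift `f(w)(t,x)`. -/
noncomputable def drift {m n : ℕ} (D : Fin n → Fin m → ℝ) (c : Fin n → ℝ)
    (A B : Matrix (Fin n) (Fin n) ℝ) (η : Fin n → ℝ)
    (g h : (Fin n → ℝ) → Fin n → ℝ) (τ : ℝ → ℝ)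
    (w : ℝ → EuclideanSpace ℝ (Fin m) → Fin n → ℝ)
    (t : ℝ) (x : EuclideanSpace ℝ (Fin m)) (k : Fin n) : ℝ :=
  (∑ r, D k r * par2 (fun y => w t y k) r x) - c k * w t x k
    + (∑ q, A k q * g (w t x) q) + (∑ q, B k q * h (w (t - τ t) x) q) + η k

/-- A function with a negative derivative at `b` does not attain its maximum over `[a, b]`
at `b`. -/
theorem not_isMaxOn_of_hasDerivAt_neg {φ : ℝ → ℝ} {a b s φ' : ℝ} (hs : s ∈ Ioc a b)
    (hd : HasDerivAt φ φ' s) (hneg : φ' < 0) : ¬ IsMaxOn φ (Icc a b) s := by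
  intro hmax
  have hslope := (hasDerivAt_iff_tendsto_slope.1 hd).eventually_lt_const hneg
  have hleft : ∀ᶠ y in nhdsWithin s (Iio s), slope φ s y < 0 :=
    hslope.filter_mono (nhdsWithin_mono s fun y hy => ne_of_lt hy)
  have hmem : ∀ᶠ y in nhdsWithin s (Iio s), y ∈ Ioo a s := Ioo_mem_nhdsLT hs.1
  obtain ⟨y, hy, hya⟩ := (hleft.and hmem).exists
  have hle : φ y ≤ φ s := hmax ⟨hya.1.le, hya.2.le.trans hs.2⟩
  rw [slope_def_field] at hy
  have := div_nonneg_of_nonpos (sub_nonpos.2 hle) (sub_nonpos.2 hya.2.le)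
  linarith

/-- A Halanay-type comparison: a solution of the delay differential inequality
`V' ≤ c V + K V(t - τ(t))` grows at most at any exponential rate `L ≥ 0` above `c + K`. -/
theorem le_mul_exp_of_delay_deriv_le {V V' τ : ℝ → ℝ} {a b τb c K L M : ℝ}
    (hτ : ∀ t, τ t ∈ Icc 0 τb) (hM : 0 ≤ M) (hK : 0 ≤ K) (hL : 0 ≤ L) (hcKL : c + K < L)
    (hcont : ContinuousOn V (Icc a b)) (hder : ∀ t ∈ Ioc a b, HasDerivAt V (V' t) t)
    (hle : ∀ t ∈ Ioc a b, V' t ≤ c * V t + K * V (t - τ t))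
    (hhist : ∀ t ∈ Icc (a - τb) a, V t ≤ M) :
    ∀ t ∈ Icc a b, V t ≤ M * Real.exp (L * (t - a)) := by
  intro t ht
  by_contra! hlt
  set φ : ℝ → ℝ := fun s => V s * Real.exp (-(L * (s - a))) with hφ
  have hφcont : ContinuousOn φ (Icc a b) := hcont.mul (by fun_prop)
  obtain ⟨s, hs, hmax⟩ := isCompact_Icc.exists_isMaxOn ⟨t, ht⟩ hφcont
  have hτb : 0 ≤ τb := (hτ 0).1.trans (hτ 0).2
  have hMs : M < φ s := by
    refine lt_of_lt_of_le ?_ (hmax ht)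
    have := mul_lt_mul_of_pos_right hlt (Real.exp_pos (-(L * (t - a))))
    rwa [mul_assoc, ← Real.exp_add, add_neg_cancel, Real.exp_zero, mul_one] at this
  have has : a < s := by
    refine lt_of_le_of_ne hs.1 ?_
    rintro rfl
    have := hhist a ⟨by linarith, le_rfl⟩
    simp only [hφ, sub_self, mul_zero, neg_zero, Real.exp_zero, mul_one] at hMs
    linarith
  have hVs : 0 < V s := pos_of_mul_pos_left (hM.trans_lt hMs) (Real.exp_pos _).le
  have hφV : φ s ≤ V s :=
    mul_le_of_le_one_right hVs.le
      (Real.exp_le_one_iff.2 (neg_nonpos.2 (mul_nonneg hL (sub_nonneg.2 hs.1))))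
  have hdelay : V (s - τ s) ≤ V s := by
    obtain ⟨h0, h1⟩ := hτ s
    rcases le_total (s - τ s) a with hsa | hsa
    · exact (hhist _ ⟨by linarith, hsa⟩).trans (hMs.le.trans hφV)
    · have h2 : φ (s - τ s) ≤ φ s := hmax ⟨hsa, by linarith [hs.2]⟩
      have h3 : φ s ≤ V s * Real.exp (-(L * (s - τ s - a))) := by
        refine mul_le_mul_of_nonneg_left (Real.exp_le_exp.2 ?_) hVs.le
        nlinarith [mul_nonneg hL h0]
      exact le_of_mul_le_mul_right (h2.trans h3) (Real.exp_pos _)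
  have hd : HasDerivAt φ ((V' s - L * V s) * Real.exp (-(L * (s - a)))) s := by
    have hlin : HasDerivAt (fun y => -(L * (y - a))) (-L) s := by
      simpa using (((hasDerivAt_id s).sub_const a).const_mul L).fun_neg
    exact ((hder s ⟨has, hs.2⟩).fun_mul hlin.exp).congr_deriv (by ring)
  refine not_isMaxOn_of_hasDerivAt_neg ⟨has, hs.2⟩ hd ?_ hmax
  refine mul_neg_of_neg_of_pos ?_ (Real.exp_pos _)
  have h1 := hle s ⟨has, hs.2⟩
  have h2 := mul_le_mul_of_nonneg_left hdelay hK
  have h3 := mul_lt_mul_of_pos_right hcKL hVs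
  linarith

/-- Solutions of `V' ≤ -μ V + B` decay exponentially up to the offset `B / μ`. -/
theorem le_mul_exp_add_of_deriv_le {V V' : ℝ → ℝ} {a b μ B : ℝ} (hμ : 0 < μ)
    (hcont : ContinuousOn V (Icc a b)) (hder : ∀ t ∈ Ioc a b, HasDerivAt V (V' t) t)
    (hle : ∀ t ∈ Ioc a b, V' t ≤ -μ * V t + B) :
    ∀ t ∈ Icc a b, V t ≤ (V a - B / μ) * Real.exp (-(μ * (t - a))) + B / μ := by
  intro t ht
  set φ : ℝ → ℝ := fun s => (V s - B / μ) * Real.exp (μ * (s - a)) with hφ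
  have hφcont : ContinuousOn φ (Icc a b) := (hcont.sub continuousOn_const).mul (by fun_prop)
  have hd : ∀ s ∈ Ioc a b,
      HasDerivAt φ ((V' s + μ * V s - B) * Real.exp (μ * (s - a))) s := by
    intro s hs
    have hlin : HasDerivAt (fun y => μ * (y - a)) μ s := by
      simpa using ((hasDerivAt_id s).sub_const a).const_mul μ
    exact (((hder s hs).sub_const (B / μ)).fun_mul hlin.exp).congr_deriv (by field_simp; ring)
  have hanti : AntitoneOn φ (Icc a b) := by
    refine antitoneOn_of_deriv_nonpos (convex_Icc a b) hφcont ?_ ?_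
    · intro s hs
      rw [interior_Icc] at hs
      exact (hd s ⟨hs.1, hs.2.le⟩).differentiableAt.differentiableWithinAt
    · intro s hs
      rw [interior_Icc] at hs
      rw [(hd s ⟨hs.1, hs.2.le⟩).deriv]
      refine mul_nonpos_of_nonpos_of_nonneg ?_ (Real.exp_pos _).le
      linarith [hle s ⟨hs.1, hs.2.le⟩]
  have h := hanti ⟨le_rfl, ht.1.trans ht.2⟩ ht ht.1
  simp only [hφ, sub_self, mul_zero, Real.exp_zero, mul_one] at h
  have h2 := mul_le_mul_of_nonneg_right h (Real.exp_pos (-(μ * (t - a)))).le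
  rw [mul_assoc, ← Real.exp_add, add_neg_cancel, Real.exp_zero, mul_one] at h2
  linarith

/-- Every time after `ts i₀` lies in one of the intervals `[ts i, ts (i + 1))`. -/
theorem exists_mem_Ico_of_tendsto_atTop {ts : ℕ → ℝ} (htlim : Tendsto ts atTop atTop)
    {i₀ : ℕ} {t : ℝ} (ht : ts i₀ ≤ t) : ∃ i ≥ i₀, t ∈ Ico (ts i) (ts (i + 1)) := by
  classical
  have hex : ∃ d, t < ts (i₀ + d) := by
    obtain ⟨i, hi, hti⟩ := ((eventually_ge_atTop i₀).and (htlim.eventually_gt_atTop t)).exists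
    exact ⟨i - i₀, by rwa [Nat.add_sub_cancel' hi]⟩
  have hpos : Nat.find hex ≠ 0 := by
    intro h0
    have := Nat.find_spec hex
    rw [h0, add_zero] at this
    linarith
  obtain ⟨d, hd⟩ := Nat.exists_eq_succ_of_ne_zero hpos
  refine ⟨i₀ + d, Nat.le_add_right _ _, ?_, ?_⟩
  · exact not_lt.1 (Nat.find_min hex (by omega))
  · have := Nat.find_spec hex
    rwa [hd] at this

/-- A nonnegative function that is eventually small on the intervals `[ts i, ts (i + 1)]`
tends to zero. -/
theorem tendsto_zero_of_eventually_small_on_Icc {V : ℝ → ℝ} {ts : ℕ → ℝ}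
    (htlim : Tendsto ts atTop atTop) (hVnn : ∀ t ≥ 0, 0 ≤ V t)
    (hsmall : ∀ ε > 0, ∃ i₀, ∀ i ≥ i₀, ∀ t ∈ Icc (ts i) (ts (i + 1)), V t ≤ ε) :
    Tendsto V atTop (nhds 0) := by
  rw [Metric.tendsto_atTop]
  intro ε hε
  obtain ⟨i₀, hi₀⟩ := hsmall (ε / 2) (half_pos hε)
  refine ⟨max 0 (ts i₀), fun t ht => ?_⟩
  obtain ⟨i, hi, hti⟩ := exists_mem_Ico_of_tendsto_atTop htlim ((le_max_right _ _).trans ht)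
  have h1 := hi₀ i hi t ⟨hti.1, hti.2.le⟩
  rw [Real.dist_eq, sub_zero, abs_of_nonneg (hVnn t ((le_max_left _ _).trans ht))]
  linarith

/-- Over a control span longer than the delay, on which `V' ≤ -μ V + K V(t - τ(t))`, the
function `V` contracts by the factor `(1 / δ + K) / μ` after time `δ`. -/
theorem le_contraction_of_delay_deriv_le {V V' τ : ℝ → ℝ} {a b τb μ K M δ : ℝ}
    (hτ : ∀ t, τ t ∈ Icc 0 τb) (hM : 0 ≤ M) (hK : 0 ≤ K) (hμ : K < μ) (hδ : 0 < δ)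
    (hcont : ContinuousOn V (Icc a b)) (hder : ∀ t ∈ Ioc a b, HasDerivAt V (V' t) t)
    (hle : ∀ t ∈ Ioc a b, V' t ≤ -μ * V t + K * V (t - τ t))
    (hhist : ∀ t ∈ Icc (a - τb) a, V t ≤ M) :
    ∀ t ∈ Icc (a + δ) b, V t ≤ (1 / δ + K) / μ * M := by
  intro t ht
  have hμ0 : 0 < μ := hK.trans_lt hμ
  have hτb : 0 ≤ τb := (hτ 0).1.trans (hτ 0).2
  have hbd : ∀ s ∈ Icc (a - τb) b, V s ≤ M := by
    intro s hs
    rcases le_total s a with hsa | hsa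
    · exact hhist s ⟨hs.1, hsa⟩
    · simpa using le_mul_exp_of_delay_deriv_le (L := 0) hτ hM hK le_rfl (by linarith)
        hcont hder hle hhist s ⟨hsa, hs.2⟩
  have hle' : ∀ s ∈ Ioc a b, V' s ≤ -μ * V s + K * M := by
    intro s hs
    have := mul_le_mul_of_nonneg_left
      (hbd (s - τ s) ⟨by linarith [(hτ s).2, hs.1], by linarith [(hτ s).1, hs.2]⟩) hK
    linarith [hle s hs]
  have hta : t ∈ Icc a b := ⟨by linarith [ht.1], ht.2⟩
  have h1 := le_mul_exp_add_of_deriv_le hμ0 hcont hder hle' t hta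
  have hexp : Real.exp (-(μ * (t - a))) ≤ 1 / (μ * δ) := by
    rw [Real.exp_neg, ← one_div]
    refine one_div_le_one_div_of_le (by positivity) ?_
    have h2 : μ * δ ≤ μ * (t - a) := mul_le_mul_of_nonneg_left (by linarith [ht.1]) hμ0.le
    linarith [Real.add_one_le_exp (μ * (t - a))]
  have hVa : V a - K * M / μ ≤ M := by
    have : 0 ≤ K * M / μ := by positivity
    linarith [hhist a ⟨by linarith, le_rfl⟩]
  calc V t ≤ (V a - K * M / μ) * Real.exp (-(μ * (t - a))) + K * M / μ := h1
    _ ≤ M * (1 / (μ * δ)) + K * M / μ := by gcongr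
    _ = (1 / δ + K) / μ * M := by field_simp

/-- Scalar core of the synchronization argument: a Lyapunov function obeying delay differential
inequalities, with decay rate proportional to an adaptive gain `Ψ` on the control spans
`[ts i, ss i]`, tends to zero. -/
theorem tendsto_zero_of_adaptive_intermittent_gain {V V' Q Ψ τ : ℝ → ℝ} {ts ss : ℕ → ℝ}
    {τb θ ω ψ C K lam P κ : ℝ} (hτ : ∀ t, τ t ∈ Icc 0 τb)
    (hts0 : ts 0 = 0) (hcs : ∀ i, ts i < ss i) (hrs : ∀ i, ss i < ts (i + 1))
    (htlim : Tendsto ts atTop atTop) (hτθ : τb < θ)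
    (hspan : ∀ i, θ ≤ ss i - ts i) (hperiod : ∀ i, ts (i + 1) - ts i ≤ ω)
    (hC : 0 ≤ C) (hK : 0 ≤ K) (hlam : 0 < lam) (hP : 0 < P) (hκ : 0 < κ) (hψ : 0 < ψ)
    (hVcont : ContinuousOn V (Ici (-τb))) (hQnn : ∀ t, 0 ≤ Q t)
    (hQV : ∀ t, κ * Q t ≤ V t) (hVQ : ∀ t, V t ≤ P * Q t)
    (hVd : ∀ t > 0, HasDerivAt V (V' t) t) (hΨnn : ∀ t ≥ 0, 0 ≤ Ψ t)
    (hctrl : ∀ i, ∀ t ∈ Icc (ts i) (ss i), 0 < t →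
      V' t ≤ (C - lam * Ψ t) * V t + K * V (t - τ t))
    (hrest : ∀ i, ∀ t ∈ Ioo (ss i) (ts (i + 1)), V' t ≤ C * V t + K * V (t - τ t))
    (hΨjump : ∀ i, Ψ (ts (i + 1)) = Ψ (ss i))
    (hΨd : ∀ i, ∀ t ∈ Icc (ts i) (ss i),
      HasDerivWithinAt Ψ (ψ * sSup ((fun ς => Q (t + ς)) '' Icc (-τb) 0))
        (Icc (ts i) (ss i)) t) :
    Tendsto V atTop (nhds 0) := by
  have hτb : 0 ≤ τb := (hτ 0).1.trans (hτ 0).2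
  have hV0 : ∀ t, 0 ≤ V t := fun t => (mul_nonneg hκ.le (hQnn t)).trans (hQV t)
  have htsmono : StrictMono ts := strictMono_nat_of_lt_succ fun i => (hcs i).trans (hrs i)
  have htsnn : ∀ i, 0 ≤ ts i := fun i => hts0 ▸ htsmono.monotone (Nat.zero_le i)
  have hcontI : ∀ a b, 0 ≤ a → ContinuousOn V (Icc a b) := fun a b ha =>
    hVcont.mono fun t ht => by
      have := ht.1
      simp only [mem_Ici]
      linarith
  have hgen : ∀ t > 0, V' t ≤ C * V t + K * V (t - τ t) := by
    intro t ht
    obtain ⟨i, -, hi⟩ := exists_mem_Ico_of_tendsto_atTop (i₀ := 0) htlim (hts0.trans_le ht.le)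
    rcases le_or_gt t (ss i) with hts | hts
    · have h1 := hctrl i t ⟨hi.1, hts⟩ ht
      have h2 := mul_nonneg (mul_nonneg hlam.le (hΨnn t ht.le)) (hV0 t)
      linarith
    · exact hrest i t ⟨hts, hi.2⟩
  set L := C + K + 1 with hLdef
  have hL : 0 ≤ L := by positivity
  have hω : 0 ≤ ω := by linarith [hperiod 0, hcs 0, hrs 0]
  have hgrowth : ∀ a b M d, 0 ≤ a → 0 ≤ M → b ≤ a + d →
      (∀ t ∈ Icc (a - τb) a, V t ≤ M) → ∀ t ∈ Icc a b, V t ≤ M * Real.exp (L * d) := by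
    intro a b M d ha hM hbd hhist t ht
    have h1 := le_mul_exp_of_delay_deriv_le (c := C) (K := K) (L := L) (V' := V') hτ hM hK hL
      (by linarith) (hcontI a b ha) (fun s hs => hVd s (ha.trans_lt hs.1))
      (fun s hs => hgen s (ha.trans_lt hs.1)) hhist t ht
    refine h1.trans ?_
    have : t - a ≤ d := by linarith [ht.2]
    gcongr
  have hwin : ∀ t ≥ 0, BddAbove ((fun ς => Q (t + ς)) '' Icc (-τb) 0) := by
    intro t ht
    have hc : ContinuousOn (fun ς => V (t + ς)) (Icc (-τb) 0) :=
      hVcont.comp (by fun_prop) fun ς hς => by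
        have := hς.1
        simp only [mem_Ici]
        linarith
    obtain ⟨M, hM⟩ := isCompact_Icc.bddAbove_image hc
    refine ⟨M / κ, ?_⟩
    rintro _ ⟨ς, hς, rfl⟩
    rw [le_div_iff₀' hκ]
    exact (hQV _).trans (hM ⟨ς, hς, rfl⟩)
  have hderivnn : ∀ t, 0 ≤ ψ * sSup ((fun ς => Q (t + ς)) '' Icc (-τb) 0) := fun t =>
    mul_nonneg hψ.le (Real.sSup_nonneg (by rintro _ ⟨ς, -, rfl⟩; exact hQnn _))
  have hΨcont : ∀ i, ContinuousOn Ψ (Icc (ts i) (ss i)) := fun i t ht =>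
    (hΨd i t ht).continuousWithinAt
  have hΨdI : ∀ i, ∀ t ∈ Ioo (ts i) (ss i),
      HasDerivAt Ψ (ψ * sSup ((fun ς => Q (t + ς)) '' Icc (-τb) 0)) t := fun i t ht =>
    (hΨd i t ⟨ht.1.le, ht.2.le⟩).hasDerivAt (Icc_mem_nhds ht.1 ht.2)
  have hΨmono : ∀ i, MonotoneOn Ψ (Icc (ts i) (ss i)) := by
    intro i
    refine monotoneOn_of_deriv_nonneg (convex_Icc _ _) (hΨcont i) ?_ ?_
    · intro t ht
      rw [interior_Icc] at ht
      exact (hΨdI i t ht).differentiableAt.differentiableWithinAt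
    · intro t ht
      rw [interior_Icc] at ht
      rw [(hΨdI i t ht).deriv]
      exact hderivnn t
  have hΨseq : Monotone fun i => Ψ (ts i) := monotone_nat_of_le_succ fun i => by
    rw [hΨjump i]
    exact hΨmono i ⟨le_rfl, (hcs i).le⟩ ⟨(hcs i).le, le_rfl⟩ (hcs i).le
  refine tendsto_zero_of_eventually_small_on_Icc htlim (fun t _ => hV0 t) ?_
  by_cases hbdd : BddAbove (range fun i => Ψ (ts i))
  · -- a bounded gain forces the windowed error to be small once in every late control span
    intro ε hε
    set G := Real.exp (L * (2 * ω)) with hG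
    have hGpos : 0 < G := Real.exp_pos _
    set ε' := ε / (P * G) with hε'
    have hε'pos : 0 < ε' := by positivity
    have hlim := tendsto_atTop_ciSup hΨseq hbdd
    have hdiff : Tendsto (fun i => Ψ (ts (i + 1)) - Ψ (ts i)) atTop (nhds 0) := by
      simpa using ((tendsto_add_atTop_iff_nat 1).2 hlim).sub hlim
    have hθ : 0 < θ := hτb.trans_lt hτθ
    obtain ⟨i₀, hi₀⟩ := eventually_atTop.1
      (hdiff.eventually_lt_const (show 0 < ψ * ε' * θ by positivity))
    refine ⟨i₀ + 1, fun i hi t ht => ?_⟩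
    obtain ⟨j, rfl⟩ := Nat.exists_eq_add_of_le' (show 1 ≤ i by omega)
    obtain ⟨a, ha, hslope⟩ := exists_hasDerivAt_eq_slope Ψ _ (hcs j) (hΨcont j) (hΨdI j)
    have hjump := hi₀ j (by omega)
    rw [hΨjump j] at hjump
    have hlen : 0 < ss j - ts j := sub_pos.2 (hcs j)
    have hsup : sSup ((fun ς => Q (a + ς)) '' Icc (-τb) 0) < ε' := by
      rw [eq_div_iff hlen.ne'] at hslope
      have h1 : ψ * ε' * θ ≤ ψ * ε' * (ss j - ts j) :=
        mul_le_mul_of_nonneg_left (hspan j) (by positivity)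
      rw [← hslope] at hjump
      have h2 := lt_of_mul_lt_mul_right (hjump.trans_le h1) hlen.le
      exact lt_of_mul_lt_mul_left h2 hψ.le
    have ha0 : 0 ≤ a := (htsnn j).trans ha.1.le
    have hhist : ∀ s ∈ Icc (a - τb) a, V s ≤ P * ε' := by
      intro s hs
      have hmem : Q s ∈ (fun ς => Q (a + ς)) '' Icc (-τb) 0 :=
        ⟨s - a, ⟨by linarith [hs.1], by linarith [hs.2]⟩, by simp⟩
      exact (hVQ s).trans
        (mul_le_mul_of_nonneg_left ((le_csSup (hwin a ha0) hmem).trans hsup.le) hP.le)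
    have h := hgrowth a (ts (j + 1 + 1)) (P * ε') (2 * ω) ha0 (by positivity)
      (by linarith [hperiod j, hperiod (j + 1), ha.1]) hhist t
      ⟨by linarith [ht.1, ha.2, hrs j], ht.2⟩
    refine h.trans_eq ?_
    rw [hε', ← hG]
    field_simp
  · -- an unbounded gain makes `V` contract by a factor of two over every late period
    set G := Real.exp (L * ω) with hG
    have hG1 : 1 ≤ G := Real.one_le_exp (mul_nonneg hL hω)
    set δ := θ - τb with hδ
    have hδpos : 0 < δ := sub_pos.2 hτθ
    set μ := K + 1 + 2 * G * (1 / δ + K) with hμ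
    have hμpos : 0 < μ := by positivity
    have hμK : K < μ := by
      have : 0 < 2 * G * (1 / δ + K) := by positivity
      linarith
    have hrho : (1 / δ + K) / μ * G ≤ 1 / 2 := by
      rw [div_mul_eq_mul_div, div_le_iff₀ hμpos]
      linarith
    obtain ⟨i₀, hi₀⟩ : ∃ i₀, (μ + C) / lam ≤ Ψ (ts i₀) := by
      by_contra! hcon
      exact hbdd ⟨(μ + C) / lam, by rintro _ ⟨i, rfl⟩; exact (hcon i).le⟩
    have hstep : ∀ i ≥ i₀, ∀ M ≥ 0, (∀ t ∈ Icc (ts i - τb) (ts i), V t ≤ M) →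
        ∀ t ∈ Icc (ts (i + 1) - τb) (ts (i + 1)), V t ≤ M / 2 := by
      intro i hi M hM hhist
      have hc := le_contraction_of_delay_deriv_le (V' := V') hτ hM hK hμK hδpos
        (hcontI (ts i) (ss i) (htsnn i)) (fun s hs => hVd s ((htsnn i).trans_lt hs.1))
        (fun s hs => by
          have hs0 := (htsnn i).trans_lt hs.1
          have hΨs : (μ + C) / lam ≤ Ψ s := (hi₀.trans (hΨseq hi)).trans
            (hΨmono i ⟨le_rfl, (hcs i).le⟩ ⟨hs.1.le, hs.2⟩ hs.1.le)
          rw [div_le_iff₀' hlam] at hΨs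
          have h1 := hctrl i s ⟨hs.1.le, hs.2⟩ hs0
          have h2 := mul_le_mul_of_nonneg_right
            (show C - lam * Ψ s ≤ -μ by linarith) (hV0 s)
          linarith) hhist
      have hρM : 0 ≤ (1 / δ + K) / μ * M := by positivity
      have hend : (1 / δ + K) / μ * M * G ≤ M / 2 := by
        have := mul_le_mul_of_nonneg_right hrho hM
        linarith
      have hss : ∀ t ∈ Icc (ss i - τb) (ss i), V t ≤ (1 / δ + K) / μ * M := fun t ht =>
        hc t ⟨by linarith [ht.1, hspan i], ht.2⟩
      intro t ht
      rcases le_total t (ss i) with hts | hts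
      · have h1 := hss t ⟨by linarith [ht.1, hrs i], hts⟩
        have h2 := le_mul_of_one_le_right hρM hG1
        linarith
      · exact (hgrowth (ss i) (ts (i + 1)) _ ω ((htsnn i).trans (hcs i).le) hρM
          (by linarith [hperiod i, hcs i]) hss t ⟨hts, ht.2⟩).trans hend
    obtain ⟨M₀, hM₀⟩ := isCompact_Icc.bddAbove_image
      (hVcont.mono (show Icc (ts i₀ - τb) (ts i₀) ⊆ Ici (-τb) from fun t ht => by
        have h1 := ht.1
        have h2 := htsnn i₀
        simp only [mem_Ici]
        linarith))
    have hM₀nn : 0 ≤ M₀ :=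
      (hV0 (ts i₀)).trans (hM₀ ⟨ts i₀, ⟨by linarith, le_rfl⟩, rfl⟩)
    have hiter : ∀ d, ∀ t ∈ Icc (ts (i₀ + d) - τb) (ts (i₀ + d)), V t ≤ M₀ * (1 / 2) ^ d := by
      intro d
      induction d with
      | zero => intro t ht; simpa using hM₀ ⟨t, ht, rfl⟩
      | succ d ih =>
        intro t ht
        have := hstep (i₀ + d) (Nat.le_add_right _ _) _ (by positivity) ih t ht
        rw [pow_succ]
        linarith
    intro ε hε
    have hpow : Tendsto (fun d : ℕ => M₀ * (1 / 2 : ℝ) ^ d * G) atTop (nhds 0) := by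
      simpa using ((tendsto_pow_atTop_nhds_zero_of_lt_one (by norm_num)
        (by norm_num : (1 / 2 : ℝ) < 1)).const_mul M₀).mul_const G
    obtain ⟨d₀, hd₀⟩ := eventually_atTop.1 (hpow.eventually_lt_const hε)
    refine ⟨i₀ + d₀, fun i hi t ht => ?_⟩
    obtain ⟨d, rfl⟩ := Nat.exists_eq_add_of_le (show i₀ ≤ i by omega)
    exact (hgrowth _ _ _ ω (htsnn _) (by positivity) (by linarith [hperiod (i₀ + d)])
      (hiter d) t ht).trans (hd₀ d (by omega)).le

/-- An irreducible matrix with nonnegative off-diagonal entries and zero row sums has a positive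
left null vector. -/
theorem exists_pos_left_null_vector {ι : Type*} [Fintype ι] [DecidableEq ι] [Nonempty ι]
    {Ξ : Matrix ι ι ℝ} (hoff : ∀ j k, j ≠ k → 0 ≤ Ξ j k) (hrow : ∀ j, ∑ k, Ξ j k = 0)
    (hirr : ∀ S : Finset ι, S.Nonempty → S ≠ Finset.univ → ∃ j ∈ S, ∃ k, k ∉ S ∧ 0 < Ξ j k) :
    ∃ p : ι → ℝ, (∀ j, 0 < p j) ∧ ∀ k, ∑ j, p j * Ξ j k = 0 := by
  have hdet : Ξ.det = 0 := by
    refine Matrix.exists_mulVec_eq_zero_iff.1 ⟨fun _ => 1, ?_, ?_⟩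
    · exact fun h => one_ne_zero (congrFun h (Classical.arbitrary ι))
    · ext j
      simpa [Matrix.mulVec, dotProduct] using hrow j
  obtain ⟨y, hy0, hy⟩ := Matrix.exists_vecMul_eq_zero_iff.2 hdet
  have hy' : ∀ k, ∑ j, y j * Ξ j k = 0 := fun k => by
    simpa [Matrix.vecMul, dotProduct] using congrFun hy k
  have habs : ∀ k, 0 ≤ ∑ j, |y j| * Ξ j k := by
    intro k
    have h1 : y k * Ξ k k = -∑ j ∈ Finset.univ.erase k, y j * Ξ j k := by
      have := hy' k
      rw [← Finset.add_sum_erase _ _ (Finset.mem_univ k)] at this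
      linarith
    have h2 : |y k| * |Ξ k k| ≤ ∑ j ∈ Finset.univ.erase k, |y j| * Ξ j k := by
      rw [← abs_mul, h1, abs_neg]
      refine (Finset.abs_sum_le_sum_abs _ _).trans (Finset.sum_le_sum fun j hj => ?_)
      rw [abs_mul, abs_of_nonneg (hoff j k (Finset.ne_of_mem_erase hj))]
    rw [← Finset.add_sum_erase _ _ (Finset.mem_univ k)]
    have h3 := mul_le_mul_of_nonneg_left (neg_abs_le (Ξ k k)) (abs_nonneg (y k))
    linarith
  have hsum : ∑ k, ∑ j, |y j| * Ξ j k = 0 := by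
    rw [Finset.sum_comm]
    refine Finset.sum_eq_zero fun j _ => ?_
    rw [← Finset.mul_sum, hrow j, mul_zero]
  have hnull : ∀ k, ∑ j, |y j| * Ξ j k = 0 := fun k =>
    (Finset.sum_eq_zero_iff_of_nonneg fun k _ => habs k).1 hsum k (Finset.mem_univ k)
  refine ⟨fun j => |y j|, fun j => ?_, hnull⟩
  set S : Finset ι := Finset.univ.filter fun j => y j ≠ 0 with hS
  have hSne : S.Nonempty := by
    obtain ⟨i, hi⟩ := Function.ne_iff.1 hy0
    exact ⟨i, by simpa [hS] using hi⟩
  have hSuniv : S = Finset.univ := by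
    by_contra hne
    obtain ⟨i, hi, k, hk, hpos⟩ := hirr S hSne hne
    have hyk : y k = 0 := by simpa [hS] using hk
    have hyi : y i ≠ 0 := by simpa [hS] using hi
    have hterm : ∀ j ∈ Finset.univ, 0 ≤ |y j| * Ξ j k := by
      intro j _
      rcases eq_or_ne j k with rfl | hjk
      · simp [hyk]
      · exact mul_nonneg (abs_nonneg _) (hoff j k hjk)
    have := (Finset.sum_eq_zero_iff_of_nonneg hterm).1 (hnull k) i (Finset.mem_univ i)
    exact (mul_pos (abs_pos.2 hyi) hpos).ne' this
  have hj : j ∈ S := hSuniv ▸ Finset.mem_univ j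
  exact abs_pos.2 (by simpa [hS] using hj)

/-- With zero row sums and a left null vector `p`, the weighted quadratic form of `Ξ` is a sum
of squared differences. -/
theorem weighted_quadratic_form_eq {ι : Type*} [Fintype ι] {Ξ : Matrix ι ι ℝ} {p : ι → ℝ}
    (hrow : ∀ j, ∑ k, Ξ j k = 0) (hp : ∀ k, ∑ j, p j * Ξ j k = 0) (x : ι → ℝ) :
    ∑ j, p j * (x j * ∑ k, Ξ j k * x k)
      = -(1 / 2) * ∑ j, ∑ k, p j * Ξ j k * (x j - x k) ^ 2 := by
  have h1 : ∑ j, ∑ k, p j * Ξ j k * x j ^ 2 = 0 := by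
    refine Finset.sum_eq_zero fun j _ => ?_
    rw [← Finset.sum_mul, ← Finset.mul_sum, hrow j]
    ring
  have h2 : ∑ j, ∑ k, p j * Ξ j k * x k ^ 2 = 0 := by
    rw [Finset.sum_comm]
    refine Finset.sum_eq_zero fun k _ => ?_
    rw [← Finset.sum_mul, hp k, zero_mul]
  have h3 : ∑ j, ∑ k, p j * Ξ j k * (x j - x k) ^ 2
      = ∑ j, ∑ k, p j * Ξ j k * x j ^ 2 + ∑ j, ∑ k, p j * Ξ j k * x k ^ 2
        - 2 * ∑ j, p j * (x j * ∑ k, Ξ j k * x k) := by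
    simp only [Finset.mul_sum, ← Finset.sum_add_distrib, ← Finset.sum_sub_distrib]
    exact Finset.sum_congr rfl fun j _ => Finset.sum_congr rfl fun k _ => by ring
  rw [h3, h1, h2]
  ring

/-- The weighted squared differences are nonnegative whatever the sign of the diagonal of `Ξ`. -/
theorem weighted_sq_diff_nonneg {ι : Type*} {Ξ : Matrix ι ι ℝ} {p : ι → ℝ}
    (hoff : ∀ j k, j ≠ k → 0 ≤ Ξ j k) (hp : ∀ j, 0 < p j) (x : ι → ℝ) (j k : ι) :
    0 ≤ p j * Ξ j k * (x j - x k) ^ 2 := by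
  rcases eq_or_ne j k with rfl | hjk
  · simp
  · exact mul_nonneg (mul_nonneg (hp j).le (hoff j k hjk)) (sq_nonneg _)

/-- Pinning a single node makes the weighted quadratic form of an irreducible coupling matrix
negative definite. -/
theorem exists_pinned_quadratic_form_le {ι : Type*} [Fintype ι] [DecidableEq ι]
    {Ξ : Matrix ι ι ℝ} {p : ι → ℝ} (i₀ : ι)
    (hoff : ∀ j k, j ≠ k → 0 ≤ Ξ j k) (hrow : ∀ j, ∑ k, Ξ j k = 0)
    (hirr : ∀ S : Finset ι, S.Nonempty → S ≠ Finset.univ → ∃ j ∈ S, ∃ k, k ∉ S ∧ 0 < Ξ j k)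
    (hp : ∀ j, 0 < p j) (hnull : ∀ k, ∑ j, p j * Ξ j k = 0) {σ : ℝ} (hσ : 0 < σ) :
    ∃ lam > 0, ∀ x : ι → ℝ,
      ∑ j, p j * (x j * ∑ k, Ξ j k * x k) - p i₀ * σ * x i₀ ^ 2
        ≤ -lam * ∑ j, p j * x j ^ 2 := by
  set F : (ι → ℝ) → ℝ := fun x =>
    1 / 2 * ∑ j, ∑ k, p j * Ξ j k * (x j - x k) ^ 2 + p i₀ * σ * x i₀ ^ 2 with hF
  have hFcont : Continuous F := by fun_prop
  have hsumnn : ∀ x : ι → ℝ, 0 ≤ ∑ j, ∑ k, p j * Ξ j k * (x j - x k) ^ 2 := fun x =>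
    Finset.sum_nonneg fun j _ => Finset.sum_nonneg fun k _ => weighted_sq_diff_nonneg hoff hp x j k
  have hFpos : ∀ x, x ≠ 0 → 0 < F x := by
    intro x hx
    by_contra! hle
    have hσp : 0 < p i₀ * σ := mul_pos (hp i₀) hσ
    have hsq : 0 ≤ p i₀ * σ * x i₀ ^ 2 := by positivity
    have hs := hsumnn x
    have hx0 : x i₀ = 0 := by
      have h0 : p i₀ * σ * x i₀ ^ 2 = 0 := by simp only [hF] at hle; linarith
      simpa [hσp.ne'] using h0
    have hs0 : ∑ j, ∑ k, p j * Ξ j k * (x j - x k) ^ 2 = 0 := by simp only [hF] at hle; linarith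
    have hterm : ∀ j k, p j * Ξ j k * (x j - x k) ^ 2 = 0 := by
      intro j k
      have h1 := (Finset.sum_eq_zero_iff_of_nonneg fun j _ => Finset.sum_nonneg fun k _ =>
        weighted_sq_diff_nonneg hoff hp x j k).1 hs0 j (Finset.mem_univ j)
      exact (Finset.sum_eq_zero_iff_of_nonneg fun k _ =>
        weighted_sq_diff_nonneg hoff hp x j k).1 h1 k (Finset.mem_univ k)
    set S : Finset ι := Finset.univ.filter fun j => x j = 0 with hS
    have hSne : S.Nonempty := ⟨i₀, by simpa [hS] using hx0⟩
    have hSu : S ≠ Finset.univ := by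
      intro h
      refine hx (funext fun j => ?_)
      have hj : j ∈ S := h ▸ Finset.mem_univ j
      simpa [hS] using hj
    obtain ⟨j, hj, k, hk, hpos⟩ := hirr S hSne hSu
    have hxj : x j = 0 := by simpa [hS] using hj
    have hxk : x k ≠ 0 := by simpa [hS] using hk
    have h := hterm j k
    rw [hxj, zero_sub, neg_sq] at h
    have : 0 < p j * Ξ j k * x k ^ 2 := mul_pos (mul_pos (hp j) hpos) (by positivity)
    exact this.ne' h
  have hFhom : ∀ (r : ℝ) x, F (r • x) = r ^ 2 * F x := by
    intro r x
    simp only [hF, Pi.smul_apply, smul_eq_mul, mul_add, Finset.mul_sum]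
    congr 1
    · exact Finset.sum_congr rfl fun j _ => Finset.sum_congr rfl fun k _ => by ring
    · ring
  have hne : (Metric.sphere (0 : ι → ℝ) 1).Nonempty := by
    have : Nontrivial (ι → ℝ) := ⟨⟨0, fun _ => 1, fun h => zero_ne_one (congrFun h i₀)⟩⟩
    exact (NormedSpace.sphere_nonempty).2 zero_le_one
  obtain ⟨z, hz, hzmin⟩ := (isCompact_sphere (0 : ι → ℝ) 1).exists_isMinOn hne hFcont.continuousOn
  have hz0 : z ≠ 0 := ne_zero_of_mem_unit_sphere ⟨z, hz⟩
  have hμ := hFpos z hz0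
  have hlow : ∀ x, F z * ‖x‖ ^ 2 ≤ F x := by
    intro x
    rcases eq_or_ne x 0 with rfl | hx
    · simp [hF]
    · have hn : 0 < ‖x‖ := norm_pos_iff.2 hx
      have hmem : ‖x‖⁻¹ • x ∈ Metric.sphere (0 : ι → ℝ) 1 := by
        simp [norm_smul, hn.ne']
      have h1 : F z ≤ F (‖x‖⁻¹ • x) := hzmin hmem
      rw [hFhom] at h1
      have h2 := mul_le_mul_of_nonneg_right h1 (sq_nonneg ‖x‖)
      rw [mul_right_comm, ← mul_pow, inv_mul_cancel₀ hn.ne', one_pow, one_mul] at h2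
      exact h2
  have hPpos : 0 < ∑ j, p j := Finset.sum_pos (fun j _ => hp j) ⟨i₀, Finset.mem_univ _⟩
  refine ⟨F z / ∑ j, p j, div_pos hμ hPpos, fun x => ?_⟩
  have hnorm : ∑ j, p j * x j ^ 2 ≤ (∑ j, p j) * ‖x‖ ^ 2 := by
    rw [Finset.sum_mul]
    refine Finset.sum_le_sum fun j _ => mul_le_mul_of_nonneg_left ?_ (hp j).le
    rw [← sq_abs]
    exact pow_le_pow_left₀ (abs_nonneg _) (norm_le_pi_norm x j) 2
  have h1 : F z / (∑ j, p j) * ∑ j, p j * x j ^ 2 ≤ F x := by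
    refine le_trans ?_ (hlow x)
    rw [div_mul_eq_mul_div, div_le_iff₀ hPpos]
    have := mul_le_mul_of_nonneg_left hnorm hμ.le
    linarith
  rw [weighted_quadratic_form_eq hrow hnull x]
  simp only [hF] at h1 ⊢
  linarith

/-- The closure of an open box is the closed box. -/
theorem closure_box {ι : Type*} [Fintype ι] {l : ι → ℝ} (hl : ∀ r, 0 < l r) :
    closure {x : EuclideanSpace ℝ ι | ∀ r, |x r| < l r}
      = {x : EuclideanSpace ℝ ι | ∀ r, |x r| ≤ l r} := by
  have h1 : {x : EuclideanSpace ℝ ι | ∀ r, |x r| < l r}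
      = (EuclideanSpace.equiv ι ℝ).toHomeomorph ⁻¹' (pi univ fun r => Ioo (-l r) (l r)) := by
    ext x
    simp [abs_lt]
  rw [h1, ← Homeomorph.preimage_closure, closure_pi_set]
  ext x
  have h2 : ∀ r, closure (Ioo (-l r) (l r)) = Icc (-l r) (l r) := fun r =>
    closure_Ioo (by linarith [hl r])
  simp [h2, abs_le, Pi.le_def, forall_and]

theorem isOpen_box {ι : Type*} [Fintype ι] (l : ι → ℝ) :
    IsOpen {x : EuclideanSpace ℝ ι | ∀ r, |x r| < l r} := by
  simp only [Set.ofPred_forall]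
  exact isOpen_iInter_of_finite fun r => isOpen_lt (by fun_prop) continuous_const

theorem isCompact_closure_box {ι : Type*} [Fintype ι] (l : ι → ℝ) :
    IsCompact (closure {x : EuclideanSpace ℝ ι | ∀ r, |x r| < l r}) := by
  refine Bornology.IsBounded.isCompact_closure ?_
  refine (Metric.isBounded_closedBall (x := (0 : EuclideanSpace ℝ ι))
    (r := Real.sqrt (∑ r, l r ^ 2))).subset fun x hx => ?_
  rw [mem_closedBall_zero_iff, EuclideanSpace.norm_eq]
  refine Real.sqrt_le_sqrt (Finset.sum_le_sum fun r _ => ?_)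
  exact pow_le_pow_left₀ (norm_nonneg _) (hx r).le 2

/-- The integral over a box of a partial derivative of a function vanishing on the boundary is
zero. -/
theorem integral_box_fderiv_single_eq_zero {m : ℕ} {l : Fin (m + 1) → ℝ} (hl : ∀ r, 0 < l r)
    {Ω : Set (EuclideanSpace ℝ (Fin (m + 1)))}
    (hΩ : Ω = {x : EuclideanSpace ℝ (Fin (m + 1)) | ∀ r, |x r| < l r})
    {F : EuclideanSpace ℝ (Fin (m + 1)) → ℝ}
    {F' : EuclideanSpace ℝ (Fin (m + 1)) → EuclideanSpace ℝ (Fin (m + 1)) →L[ℝ] ℝ}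
    (r : Fin (m + 1)) (hFc : ContinuousOn F (closure Ω)) (hF0 : ∀ x ∈ frontier Ω, F x = 0)
    (hFd : ∀ x ∈ Ω, HasFDerivAt F (F' x) x)
    (hintegrable : IntegrableOn (fun x => F' x (EuclideanSpace.single r 1)) Ω) :
    ∫ x in Ω, F' x (EuclideanSpace.single r 1) = 0 := by
  have hopen : IsOpen Ω := hΩ ▸ isOpen_box l
  have hclos : closure Ω = {x : EuclideanSpace ℝ (Fin (m + 1)) | ∀ r, |x r| ≤ l r} := by
    rw [hΩ, closure_box hl]
  have hfront : ∀ x ∈ closure Ω, ∀ i, |x i| = l i → x ∈ frontier Ω := by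
    intro x hx i hi
    rw [hopen.frontier_eq]
    refine ⟨hx, fun hxΩ => ?_⟩
    rw [hΩ] at hxΩ
    exact (hxΩ i).ne hi
  let e : (Fin (m + 1) → ℝ) ≃L[ℝ] EuclideanSpace ℝ (Fin (m + 1)) :=
    (EuclideanSpace.equiv (Fin (m + 1)) ℝ).symm
  have hemp : MeasurePreserving e volume volume := PiLp.volume_preserving_toLp (Fin (m + 1))
  have heemb : MeasurableEmbedding e := e.toHomeomorph.measurableEmbedding
  have hpre : e ⁻¹' Ω = pi univ fun i => Ioo (-l i) (l i) := by
    ext y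
    simp [hΩ, e, abs_lt]
  have hpreC : ∀ y ∈ Icc (-l) l, e y ∈ closure Ω := by
    intro y hy
    rw [hclos]
    exact fun i => abs_le.2 ⟨hy.1 i, hy.2 i⟩
  have hae : (e ⁻¹' Ω : Set (Fin (m + 1) → ℝ)) =ᵐ[volume] Icc (-l) l := by
    rw [hpre]
    exact Measure.univ_pi_Ioo_ae_eq_Icc (f := -l) (g := l)
  have hesing : ∀ i : Fin (m + 1), e (Pi.single i 1) = EuclideanSpace.single i 1 := fun i => rfl
  set f : Fin (m + 1) → (Fin (m + 1) → ℝ) → ℝ := fun i y => if i = r then F (e y) else 0 with hf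
  set f' : Fin (m + 1) → (Fin (m + 1) → ℝ) → (Fin (m + 1) → ℝ) →L[ℝ] ℝ := fun i y =>
    if i = r then (F' (e y)).comp (e : (Fin (m + 1) → ℝ) →L[ℝ] _) else 0 with hf'
  have hdiv : ∀ y, ∑ i, f' i y (Pi.single i 1) = F' (e y) (EuclideanSpace.single r 1) := by
    intro y
    rw [Finset.sum_eq_single r]
    · simp [hf', hesing]
    · intro i _ hi
      simp [hf', hi]
    · simp
  have hmain := integral_divergence_of_hasFDerivAt_off_countable' (-l) l
    (fun i => by simp only [Pi.neg_apply]; linarith [hl i]) f f' ∅ countable_empty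
    (fun i => by
      by_cases hi : i = r
      · simp only [hf, hi, if_true]
        exact hFc.comp e.continuous.continuousOn hpreC
      · simp only [hf, hi, if_false]
        exact continuousOn_const)
    (fun y hy i => by
      by_cases hi : i = r
      · simp only [hf, hf', hi, if_true]
        have hyΩ : e y ∈ Ω := by
          have : y ∈ e ⁻¹' Ω := by rw [hpre]; simpa using hy.1
          exact this
        exact (hFd _ hyΩ).comp y e.hasFDerivAt
      · simp only [hf, hf', hi, if_false]
        exact hasFDerivAt_const _ _)
    (by
      simp only [hdiv]
      refine IntegrableOn.congr_set_ae ?_ hae.symm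
      exact (hemp.integrableOn_comp_preimage heemb).2 hintegrable)
  simp only [hdiv] at hmain
  rw [← hemp.setIntegral_preimage_emb heemb (fun x => F' x (EuclideanSpace.single r 1)) Ω,
    setIntegral_congr_set hae, hmain]
  have hface : ∀ (i : Fin (m + 1)) (c : ℝ), |c| = l i →
      ∀ z ∈ Icc ((-l) ∘ i.succAbove) (l ∘ i.succAbove), f i (i.insertNth c z) = 0 := by
    intro i c hc z hz
    by_cases hi : i = r
    · simp only [hf, hi, if_true]
      subst hi
      refine hF0 _ (hfront _ ?_ i ?_)
      · rw [hclos]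
        intro k
        refine Fin.succAboveCases i ?_ (fun k => ?_) k
        · simpa [e] using hc.le
        · simpa [e] using abs_le.2 ⟨hz.1 k, hz.2 k⟩
      · simpa [e] using hc
    · simp [hf, hi]
  refine Finset.sum_eq_zero fun i _ => ?_
  rw [setIntegral_eq_zero_of_forall_eq_zero, setIntegral_eq_zero_of_forall_eq_zero, sub_zero]
  · exact fun z hz => hface i _ (by simp [abs_of_pos (hl i)]) z hz
  · exact fun z hz => hface i _ (abs_of_pos (hl i)) z hz

/-- Dissipativity of diffusion under Dirichlet boundary conditions, for the difference of two
fields that agree on the boundary. -/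
theorem integral_sub_mul_par2_sub_nonpos {m : ℕ} {l : Fin (m + 1) → ℝ} (hl : ∀ r, 0 < l r)
    {Ω : Set (EuclideanSpace ℝ (Fin (m + 1)))}
    (hΩ : Ω = {x : EuclideanSpace ℝ (Fin (m + 1)) | ∀ r, |x r| < l r})
    {u v : EuclideanSpace ℝ (Fin (m + 1)) → ℝ} (r : Fin (m + 1))
    (hu : ContDiffOn ℝ 2 u (closure Ω)) (hv : ContDiffOn ℝ 2 v (closure Ω))
    (huv : ∀ x ∈ frontier Ω, u x = v x)
    (hu1 : ContinuousOn (par u r) (closure Ω)) (hv1 : ContinuousOn (par v r) (closure Ω))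
    (hu2 : ContinuousOn (par2 u r) (closure Ω)) (hv2 : ContinuousOn (par2 v r) (closure Ω)) :
    ∫ x in Ω, (u x - v x) * (par2 u r x - par2 v r x) ≤ 0 := by
  have hopen : IsOpen Ω := hΩ ▸ isOpen_box l
  have hcomp : IsCompact (closure Ω) := hΩ ▸ isCompact_closure_box l
  have hintegrableΩ : ∀ {φ : EuclideanSpace ℝ (Fin (m + 1)) → ℝ}, ContinuousOn φ (closure Ω) →
      IntegrableOn φ Ω := fun hφ => (hφ.integrableOn_compact hcomp).mono_set subset_closure
  have hfd : ∀ {φ : EuclideanSpace ℝ (Fin (m + 1)) → ℝ}, ContDiffOn ℝ 2 φ (closure Ω) →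
      ∀ x ∈ Ω, DifferentiableAt ℝ φ x ∧ DifferentiableAt ℝ (par φ r) x := by
    intro φ hφ x hx
    have hφΩ : ContDiffOn ℝ 2 φ Ω := hφ.mono subset_closure
    refine ⟨(hφΩ.contDiffAt (hopen.mem_nhds hx)).differentiableAt two_ne_zero, ?_⟩
    have h1 : ContDiffOn ℝ 1 (fderiv ℝ φ) Ω :=
      hφΩ.fderiv_of_isOpen hopen (by norm_num)
    have h2 := (h1.contDiffAt (hopen.mem_nhds hx)).differentiableAt one_ne_zero
    exact h2.clm_apply (differentiableAt_const _)
  have hd2 : ContinuousOn (fun x => (u x - v x) * (par2 u r x - par2 v r x)) (closure Ω) :=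
    (hu.continuousOn.sub hv.continuousOn).mul (hu2.sub hv2)
  have hd1 : ContinuousOn (fun x => (par u r x - par v r x) ^ 2) (closure Ω) := (hu1.sub hv1).pow 2
  have hval : ∀ x, ((u x - v x) • (fderiv ℝ (par u r) x - fderiv ℝ (par v r) x)
      + (par u r x - par v r x) • (fderiv ℝ u x - fderiv ℝ v x)) (EuclideanSpace.single r 1)
      = (u x - v x) * (par2 u r x - par2 v r x) + (par u r x - par v r x) ^ 2 := by
    intro x
    simp only [_root_.add_apply, _root_.smul_apply, _root_.sub_apply, smul_eq_mul, par2, par]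
    ring
  have hzero := integral_box_fderiv_single_eq_zero hl hΩ r
    (F := fun x => (u x - v x) * (par u r x - par v r x))
    (F' := fun x => (u x - v x) • (fderiv ℝ (par u r) x - fderiv ℝ (par v r) x)
      + (par u r x - par v r x) • (fderiv ℝ u x - fderiv ℝ v x))
    ((hu.continuousOn.sub hv.continuousOn).mul (hu1.sub hv1))
    (fun x hx => by simp [huv x hx])
    (fun x hx => by
      obtain ⟨hux, hux1⟩ := hfd hu x hx
      obtain ⟨hvx, hvx1⟩ := hfd hv x hx
      exact (hux.hasFDerivAt.sub hvx.hasFDerivAt).mul (hux1.hasFDerivAt.sub hvx1.hasFDerivAt))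
    (by
      simp only [hval]
      exact hintegrableΩ (hd2.add hd1))
  simp only [hval] at hzero
  rw [integral_add (hintegrableΩ hd2) (hintegrableΩ hd1)] at hzero
  have hsq : 0 ≤ ∫ x in Ω, (par u r x - par v r x) ^ 2 := integral_nonneg fun x => sq_nonneg _
  linarith

/-- Slices of a jointly continuous function are continuous. -/
theorem continuousOn_slice {S X Y : Type*} [TopologicalSpace S] [TopologicalSpace X]
    [TopologicalSpace Y] {φ : S → X → Y} {I : Set S} {T : Set X}
    (hφ : ContinuousOn (fun q : S × X => φ q.1 q.2) (I ×ˢ T)) {t : S} (ht : t ∈ I) :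
    ContinuousOn (φ t) T :=
  hφ.comp (f := fun x => (t, x)) (by fun_prop) fun _ hx => ⟨ht, hx⟩

/-- The integral over a set with compact closure of a jointly continuous integrand depends
continuously on the parameter. -/
theorem continuousOn_setIntegral_of_isCompact_closure {X : Type*} [TopologicalSpace X]
    [MeasurableSpace X] [OpensMeasurableSpace X] [T2Space X]
    {ν : Measure X} [IsFiniteMeasureOnCompacts ν]
    {Ω : Set X} (hΩm : MeasurableSet Ω) (hcomp : IsCompact (closure Ω))
    {φ : ℝ → X → ℝ} {a : ℝ}
    (hφ : ContinuousOn (fun q : ℝ × X => φ q.1 q.2) (Ici a ×ˢ closure Ω)) :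
    ContinuousOn (fun t => ∫ x in Ω, φ t x ∂ν) (Ici a) := by
  intro t₀ ht₀
  have hK : IsCompact (Icc a (t₀ + 1) ×ˢ closure Ω) := isCompact_Icc.prod hcomp
  obtain ⟨M, hM⟩ := hK.exists_bound_of_continuousOn
    (hφ.mono (prod_mono Icc_subset_Ici_self subset_rfl))
  have hslice : ∀ t ∈ Ici a, IntegrableOn (φ t) Ω ν := fun t ht =>
    ((continuousOn_slice hφ ht).integrableOn_compact' hcomp
      isClosed_closure.measurableSet).mono_set subset_closure
  refine continuousWithinAt_of_dominated (bound := fun _ => M) ?_ ?_ ?_ ?_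
  · filter_upwards [self_mem_nhdsWithin] with t ht using (hslice t ht).aestronglyMeasurable
  · filter_upwards [self_mem_nhdsWithin,
      mem_nhdsWithin_of_mem_nhds (Iio_mem_nhds (lt_add_one t₀))] with t ht ht'
    filter_upwards [ae_restrict_mem hΩm] with x hx
    exact hM (t, x) ⟨⟨ht, le_of_lt ht'⟩, subset_closure hx⟩
  · exact integrableOn_const
      ((measure_mono subset_closure).trans_lt hcomp.measure_lt_top).ne
  · filter_upwards [ae_restrict_mem hΩm] with x hx
    have hxc := subset_closure hx
    exact (hφ (t₀, x) ⟨ht₀, hxc⟩).comp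
      (f := fun t => (t, x)) (by fun_prop) fun t ht => ⟨ht, hxc⟩

/-- Differentiation under the integral sign over a set with compact closure. -/
theorem hasDerivAt_setIntegral_of_isCompact_closure {X : Type*} [TopologicalSpace X]
    [MeasurableSpace X] [OpensMeasurableSpace X] [T2Space X]
    {ν : Measure X} [IsFiniteMeasureOnCompacts ν]
    {Ω : Set X} (hΩm : MeasurableSet Ω) (hcomp : IsCompact (closure Ω))
    {φ φ' : ℝ → X → ℝ} {a : ℝ} (hφ : ∀ t > a, ContinuousOn (φ t) (closure Ω))
    (hφ' : ContinuousOn (fun q : ℝ × X => φ' q.1 q.2) (Ioi a ×ˢ closure Ω))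
    (hd : ∀ t > a, ∀ x ∈ Ω, HasDerivAt (fun s => φ s x) (φ' t x) t) {t₀ : ℝ} (ht₀ : a < t₀) :
    HasDerivAt (fun t => ∫ x in Ω, φ t x ∂ν) (∫ x in Ω, φ' t₀ x ∂ν) t₀ := by
  have hintegrable : ∀ {f : X → ℝ}, ContinuousOn f (closure Ω) → IntegrableOn f Ω ν := fun hf =>
    (hf.integrableOn_compact' hcomp isClosed_closure.measurableSet).mono_set subset_closure
  obtain ⟨b, hab, hbt⟩ := exists_between ht₀
  have hK : IsCompact (Icc b (t₀ + 1) ×ˢ closure Ω) := isCompact_Icc.prod hcomp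
  obtain ⟨M, hM⟩ := hK.exists_bound_of_continuousOn
    (hφ'.mono (prod_mono (fun t ht => hab.trans_le ht.1) subset_rfl))
  have hnhds : Ioo b (t₀ + 1) ∈ nhds t₀ := Ioo_mem_nhds hbt (lt_add_one t₀)
  refine (hasDerivAt_integral_of_dominated_loc_of_deriv_le (bound := fun _ => M) hnhds
    ?_ (hintegrable (hφ t₀ ht₀)) ?_ ?_ ?_ ?_).2
  · filter_upwards [Ioi_mem_nhds ht₀] with t ht using (hintegrable (hφ t ht)).aestronglyMeasurable
  · exact (hintegrable (continuousOn_slice hφ' ht₀)).aestronglyMeasurable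
  · filter_upwards [ae_restrict_mem hΩm] with x hx t ht
    exact hM (t, x) ⟨⟨ht.1.le, ht.2.le⟩, subset_closure hx⟩
  · exact integrableOn_const
      ((measure_mono subset_closure).trans_lt hcomp.measure_lt_top).ne
  · filter_upwards [ae_restrict_mem hΩm] with x hx t ht
    exact hd t (hab.trans ht.1) x hx

/-- Young's inequality for a bilinear form, with the entrywise `ℓ¹` norm as constant. -/
theorem two_mul_bilinear_le {ι : Type*} [Fintype ι] (A : Matrix ι ι ℝ) (x y : ι → ℝ) :
    ∑ k, 2 * (x k * ∑ q, A k q * y q)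
      ≤ (∑ k, ∑ q, |A k q|) * (∑ k, x k ^ 2 + ∑ k, y k ^ 2) := by
  rw [Finset.sum_mul]
  refine Finset.sum_le_sum fun k _ => ?_
  rw [Finset.mul_sum, Finset.mul_sum, Finset.sum_mul]
  refine Finset.sum_le_sum fun q _ => ?_
  have hx : x k ^ 2 ≤ ∑ k, x k ^ 2 :=
    Finset.single_le_sum (f := fun k => x k ^ 2) (fun i _ => sq_nonneg _) (Finset.mem_univ k)
  have hy : y q ^ 2 ≤ ∑ k, y k ^ 2 :=
    Finset.single_le_sum (f := fun k => y k ^ 2) (fun i _ => sq_nonneg _) (Finset.mem_univ q)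
  have hxy : |2 * (x k * y q)| ≤ x k ^ 2 + y q ^ 2 := by
    rw [abs_le]
    constructor <;> nlinarith [sq_nonneg (x k - y q), sq_nonneg (x k + y q)]
  calc 2 * (x k * (A k q * y q)) = A k q * (2 * (x k * y q)) := by ring
    _ ≤ |A k q * (2 * (x k * y q))| := le_abs_self _
    _ = |A k q| * |2 * (x k * y q)| := abs_mul _ _
    _ ≤ |A k q| * (∑ k, x k ^ 2 + ∑ k, y k ^ 2) :=
        mul_le_mul_of_nonneg_left (by linarith) (abs_nonneg _)

/-- The squared form of a Euclidean Lipschitz bound. -/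
theorem sum_sq_le_of_sqrt_le {ι : Type*} [Fintype ι] {a b : ι → ℝ} {L : ℝ} (hL : 0 ≤ L)
    (h : Real.sqrt (∑ k, a k ^ 2) ≤ L * Real.sqrt (∑ k, b k ^ 2)) :
    ∑ k, a k ^ 2 ≤ L ^ 2 * ∑ k, b k ^ 2 := by
  have ha : 0 ≤ ∑ k, a k ^ 2 := Finset.sum_nonneg fun k _ => sq_nonneg _
  have hb : 0 ≤ ∑ k, b k ^ 2 := Finset.sum_nonneg fun k _ => sq_nonneg _
  have := (Real.sqrt_le_left (mul_nonneg hL (Real.sqrt_nonneg _))).1 h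
  rwa [mul_pow, Real.sq_sqrt hb] at this

/-- Pointwise bound of the reaction part of the drift difference of two states. -/
theorem drift_sub_inner_le {m n : ℕ} {D : Fin n → Fin m → ℝ} {c : Fin n → ℝ} (hc : ∀ k, 0 < c k)
    (A B : Matrix (Fin n) (Fin n) ℝ) (η : Fin n → ℝ) {g h : (Fin n → ℝ) → Fin n → ℝ}
    {gs hs : ℝ} (hgs : 0 < gs) (hhs : 0 < hs)
    (hLipg : ∀ u v, Real.sqrt (∑ k, (g u k - g v k) ^ 2) ≤
      gs * Real.sqrt (∑ k, (u k - v k) ^ 2))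
    (hLiph : ∀ u v, Real.sqrt (∑ k, (h u k - h v k) ^ 2) ≤
      hs * Real.sqrt (∑ k, (u k - v k) ^ 2))
    (τ : ℝ → ℝ) (u v : ℝ → EuclideanSpace ℝ (Fin m) → Fin n → ℝ) (t : ℝ)
    (x : EuclideanSpace ℝ (Fin m)) :
    ∑ k, 2 * ((u t x k - v t x k) * (drift D c A B η g h τ u t x k - drift D c A B η g h τ v t x k))
      ≤ ∑ k, ∑ r, 2 * D k r * ((u t x k - v t x k)
          * (par2 (fun y => u t y k) r x - par2 (fun y => v t y k) r x))
        + ((∑ k, ∑ q, |A k q|) * (1 + gs ^ 2) + ∑ k, ∑ q, |B k q|)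
          * ∑ k, (u t x k - v t x k) ^ 2
        + (∑ k, ∑ q, |B k q|) * hs ^ 2
          * ∑ k, (u (t - τ t) x k - v (t - τ t) x k) ^ 2 := by
  have hA := two_mul_bilinear_le A (fun k => u t x k - v t x k)
    (fun q => g (u t x) q - g (v t x) q)
  have hB := two_mul_bilinear_le B (fun k => u t x k - v t x k)
    (fun q => h (u (t - τ t) x) q - h (v (t - τ t) x) q)
  have hg := sum_sq_le_of_sqrt_le hgs.le (hLipg (u t x) (v t x))
  have hh := sum_sq_le_of_sqrt_le hhs.le (hLiph (u (t - τ t) x) (v (t - τ t) x))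
  have ha : 0 ≤ ∑ k, ∑ q, |A k q| := Finset.sum_nonneg fun k _ =>
    Finset.sum_nonneg fun q _ => abs_nonneg _
  have hb : 0 ≤ ∑ k, ∑ q, |B k q| := Finset.sum_nonneg fun k _ =>
    Finset.sum_nonneg fun q _ => abs_nonneg _
  have hcE : 0 ≤ ∑ k, 2 * (c k * (u t x k - v t x k) ^ 2) := Finset.sum_nonneg fun k _ =>
    mul_nonneg two_pos.le (mul_nonneg (hc k).le (sq_nonneg _))
  have hexp : ∑ k, 2 * ((u t x k - v t x k)
        * (drift D c A B η g h τ u t x k - drift D c A B η g h τ v t x k))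
      = ∑ k, ∑ r, 2 * D k r * ((u t x k - v t x k)
          * (par2 (fun y => u t y k) r x - par2 (fun y => v t y k) r x))
        - ∑ k, 2 * (c k * (u t x k - v t x k) ^ 2)
        + ∑ k, 2 * ((u t x k - v t x k) * ∑ q, A k q * (g (u t x) q - g (v t x) q))
        + ∑ k, 2 * ((u t x k - v t x k)
          * ∑ q, B k q * (h (u (t - τ t) x) q - h (v (t - τ t) x) q)) := by
    rw [← Finset.sum_sub_distrib, ← Finset.sum_add_distrib, ← Finset.sum_add_distrib]
    refine Finset.sum_congr rfl fun k _ => ?_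
    have h1 : ∑ r, 2 * D k r * ((u t x k - v t x k)
          * (par2 (fun y => u t y k) r x - par2 (fun y => v t y k) r x))
        = 2 * ((u t x k - v t x k) * (∑ r, D k r * par2 (fun y => u t y k) r x
          - ∑ r, D k r * par2 (fun y => v t y k) r x)) := by
      rw [← Finset.sum_sub_distrib, Finset.mul_sum, Finset.mul_sum]
      exact Finset.sum_congr rfl fun r _ => by ring
    rw [h1]
    simp only [drift, mul_sub (A k _), mul_sub (B k _), Finset.sum_sub_distrib]
    ring
  rw [hexp]
  have hA' := mul_le_mul_of_nonneg_left hg ha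
  have hB' := mul_le_mul_of_nonneg_left hh hb
  linarith

/-- Energy estimate for one node: the diffusion term drops out, the reaction terms are bounded by
the current and the delayed energies, and the coupling term `R` remains. -/
theorem node_energy_le {m n : ℕ} {l : Fin (m + 1) → ℝ} (hl : ∀ r, 0 < l r)
    {Ω : Set (EuclideanSpace ℝ (Fin (m + 1)))}
    (hΩ : Ω = {x : EuclideanSpace ℝ (Fin (m + 1)) | ∀ r, |x r| < l r})
    {D : Fin n → Fin (m + 1) → ℝ} (hD : ∀ k r, 0 ≤ D k r)
    {c : Fin n → ℝ} (hc : ∀ k, 0 < c k)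
    (A B : Matrix (Fin n) (Fin n) ℝ) (η : Fin n → ℝ) {g h : (Fin n → ℝ) → Fin n → ℝ}
    {gs hs : ℝ} (hgs : 0 < gs) (hhs : 0 < hs)
    (hLipg : ∀ u v, Real.sqrt (∑ k, (g u k - g v k) ^ 2) ≤
      gs * Real.sqrt (∑ k, (u k - v k) ^ 2))
    (hLiph : ∀ u v, Real.sqrt (∑ k, (h u k - h v k) ^ 2) ≤
      hs * Real.sqrt (∑ k, (u k - v k) ^ 2))
    (τ : ℝ → ℝ) {u v : ℝ → EuclideanSpace ℝ (Fin (m + 1)) → Fin n → ℝ} {t : ℝ}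
    {ud vd R : EuclideanSpace ℝ (Fin (m + 1)) → Fin n → ℝ}
    (hux : ContDiffOn ℝ 2 (u t) (closure Ω)) (hvx : ContDiffOn ℝ 2 (v t) (closure Ω))
    (hbd : ∀ x ∈ frontier Ω, u t x = v t x)
    (hu1 : ∀ k r, ContinuousOn (par (fun y => u t y k) r) (closure Ω))
    (hv1 : ∀ k r, ContinuousOn (par (fun y => v t y k) r) (closure Ω))
    (hu2 : ∀ k r, ContinuousOn (par2 (fun y => u t y k) r) (closure Ω))
    (hv2 : ∀ k r, ContinuousOn (par2 (fun y => v t y k) r) (closure Ω))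
    (huτ : ContinuousOn (u (t - τ t)) (closure Ω)) (hvτ : ContinuousOn (v (t - τ t)) (closure Ω))
    (hud : ContinuousOn ud (closure Ω)) (hvd : ContinuousOn vd (closure Ω))
    (hR : ContinuousOn R (closure Ω))
    (hueq : ∀ x ∈ Ω, ∀ k, ud x k = drift D c A B η g h τ u t x k + R x k)
    (hveq : ∀ x ∈ Ω, ∀ k, vd x k = drift D c A B η g h τ v t x k) :
    ∫ x in Ω, ∑ k, 2 * ((u t x k - v t x k) * (ud x k - vd x k))
      ≤ ((∑ k, ∑ q, |A k q|) * (1 + gs ^ 2) + ∑ k, ∑ q, |B k q|)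
          * (∫ x in Ω, ∑ k, (u t x k - v t x k) ^ 2)
        + (∑ k, ∑ q, |B k q|) * hs ^ 2
          * (∫ x in Ω, ∑ k, (u (t - τ t) x k - v (t - τ t) x k) ^ 2)
        + ∫ x in Ω, ∑ k, 2 * ((u t x k - v t x k) * R x k) := by
  have hopen : IsOpen Ω := hΩ ▸ isOpen_box l
  have hcomp : IsCompact (closure Ω) := hΩ ▸ isCompact_closure_box l
  have hintegrableΩ : ∀ {φ : EuclideanSpace ℝ (Fin (m + 1)) → ℝ}, ContinuousOn φ (closure Ω) →
      IntegrableOn φ Ω := fun hφ => (hφ.integrableOn_compact hcomp).mono_set subset_closure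
  have hu := hux.continuousOn
  have hv := hvx.continuousOn
  have coord : ∀ {φ : EuclideanSpace ℝ (Fin (m + 1)) → Fin n → ℝ}, ContinuousOn φ (closure Ω) →
      ∀ k, ContinuousOn (fun x => φ x k) (closure Ω) := fun hφ => continuousOn_pi.1 hφ
  have hdiffc : ∀ k r, ContinuousOn (fun x => (u t x k - v t x k)
      * (par2 (fun y => u t y k) r x - par2 (fun y => v t y k) r x)) (closure Ω) := fun k r =>
    ((coord hu k).sub (coord hv k)).mul ((hu2 k r).sub (hv2 k r))
  have hI₀ : IntegrableOn (fun x => ∑ k, 2 * ((u t x k - v t x k) * (ud x k - vd x k))) Ω :=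
    hintegrableΩ (continuousOn_finsetSum _ fun k _ => continuousOn_const.mul
      (((coord hu k).sub (coord hv k)).mul ((coord hud k).sub (coord hvd k))))
  have hI₁ : IntegrableOn (fun x => ∑ k, ∑ r, 2 * D k r * ((u t x k - v t x k)
      * (par2 (fun y => u t y k) r x - par2 (fun y => v t y k) r x))) Ω :=
    hintegrableΩ (continuousOn_finsetSum _ fun k _ => continuousOn_finsetSum _ fun r _ =>
      continuousOn_const.mul (hdiffc k r))
  have hI₂ : IntegrableOn (fun x => ∑ k, (u t x k - v t x k) ^ 2) Ω :=
    hintegrableΩ (continuousOn_finsetSum _ fun k _ => ((coord hu k).sub (coord hv k)).pow 2)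
  have hI₃ : IntegrableOn (fun x => ∑ k, (u (t - τ t) x k - v (t - τ t) x k) ^ 2) Ω :=
    hintegrableΩ (continuousOn_finsetSum _ fun k _ => ((coord huτ k).sub (coord hvτ k)).pow 2)
  have hI₄ : IntegrableOn (fun x => ∑ k, 2 * ((u t x k - v t x k) * R x k)) Ω :=
    hintegrableΩ (continuousOn_finsetSum _ fun k _ => continuousOn_const.mul
      (((coord hu k).sub (coord hv k)).mul (coord hR k)))
  set a := (∑ k, ∑ q, |A k q|) * (1 + gs ^ 2) + ∑ k, ∑ q, |B k q| with ha
  set b := (∑ k, ∑ q, |B k q|) * hs ^ 2 with hb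
  have hmono := setIntegral_mono_on hI₀
    (((hI₁.add (hI₂.const_mul a)).add (hI₃.const_mul b)).add hI₄) hopen.measurableSet
    (fun x hx => by
      have h1 := drift_sub_inner_le (D := D) hc A B η hgs hhs hLipg hLiph τ u v t x
      have h2 : ∑ k, 2 * ((u t x k - v t x k) * (ud x k - vd x k))
          = ∑ k, 2 * ((u t x k - v t x k)
              * (drift D c A B η g h τ u t x k - drift D c A B η g h τ v t x k))
            + ∑ k, 2 * ((u t x k - v t x k) * R x k) := by
        rw [← Finset.sum_add_distrib]
        refine Finset.sum_congr rfl fun k _ => ?_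
        rw [hueq x hx k, hveq x hx k]
        ring
      rw [h2]
      simp only [Pi.add_apply]
      linarith)
  have hdiff : ∫ x in Ω, ∑ k, ∑ r, 2 * D k r * ((u t x k - v t x k)
      * (par2 (fun y => u t y k) r x - par2 (fun y => v t y k) r x)) ≤ 0 := by
    have hJ : ∀ k r, IntegrableOn (fun x => 2 * D k r * ((u t x k - v t x k)
        * (par2 (fun y => u t y k) r x - par2 (fun y => v t y k) r x))) Ω := fun k r =>
      (hintegrableΩ (hdiffc k r)).const_mul _
    rw [integral_finsetSum _ fun k _ => integrable_finsetSum _ fun r _ => hJ k r]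
    refine Finset.sum_nonpos fun k _ => ?_
    rw [integral_finsetSum _ fun r _ => hJ k r]
    refine Finset.sum_nonpos fun r _ => ?_
    rw [integral_const_mul]
    exact mul_nonpos_of_nonneg_of_nonpos (mul_nonneg two_pos.le (hD k r))
      (integral_sub_mul_par2_sub_nonpos hl hΩ r (contDiffOn_pi.1 hux k) (contDiffOn_pi.1 hvx k)
        (fun x hx => congrFun (hbd x hx) k) (hu1 k r) (hv1 k r) (hu2 k r) (hv2 k r))
  rw [integral_add' ((hI₁.add (hI₂.const_mul a)).add (hI₃.const_mul b)) hI₄,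
    integral_add' (hI₁.add (hI₂.const_mul a)) (hI₃.const_mul b),
    integral_add' hI₁ (hI₂.const_mul a), integral_const_mul, integral_const_mul] at hmono
  linarith

/-- With zero row sums, the coupling of the states is the coupling of the errors. -/
theorem coupling_eq_coupling_error {ι : Type*} [Fintype ι] {Ξ : Matrix ι ι ℝ}
    (hrow : ∀ j, ∑ k, Ξ j k = 0) (γ P : ℝ) (W : ι → ℝ) (j : ι) :
    ∑ i, Ξ j i * (γ * W i) = γ * ∑ i, Ξ j i * (W i - P) := by
  simp only [mul_sub, Finset.sum_sub_distrib]
  rw [← Finset.sum_mul, hrow j, zero_mul, mul_zero, sub_zero, Finset.mul_sum]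
  exact Finset.sum_congr rfl fun i _ => by ring

/-- Diffusive coupling does not increase the weighted energy. -/
theorem weighted_coupling_nonpos {ι κ : Type*} [Fintype ι] [Fintype κ] {Ξ : Matrix ι ι ℝ}
    {p : ι → ℝ} (hoff : ∀ j k, j ≠ k → 0 ≤ Ξ j k) (hrow : ∀ j, ∑ k, Ξ j k = 0)
    (hp : ∀ j, 0 < p j) (hnull : ∀ k, ∑ j, p j * Ξ j k = 0) {γ : κ → ℝ} (hγ : ∀ k, 0 < γ k)
    (W : ι → κ → ℝ) (P : κ → ℝ) :
    ∑ j, p j * ∑ k, 2 * ((W j k - P k) * ∑ i, Ξ j i * (γ k * W i k)) ≤ 0 := by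
  have hsplit : ∑ j, p j * ∑ k, 2 * ((W j k - P k) * ∑ i, Ξ j i * (γ k * W i k))
      = ∑ k, 2 * γ k * ∑ j, p j * ((W j k - P k) * ∑ i, Ξ j i * (W i k - P k)) := by
    simp only [fun j k => coupling_eq_coupling_error hrow (γ k) (P k) (fun i => W i k) j]
    simp only [Finset.mul_sum (s := (Finset.univ : Finset κ)) _ (p _)]
    rw [Finset.sum_comm]
    refine Finset.sum_congr rfl fun k _ => ?_
    rw [Finset.mul_sum]
    exact Finset.sum_congr rfl fun j _ => by ring
  rw [hsplit]
  refine Finset.sum_nonpos fun k _ => mul_nonpos_of_nonneg_of_nonpos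
    (mul_nonneg two_pos.le (hγ k).le) ?_
  rw [weighted_quadratic_form_eq hrow hnull fun j => W j k - P k]
  have := Finset.sum_nonneg fun j (_ : j ∈ Finset.univ) => Finset.sum_nonneg fun i
    (_ : i ∈ Finset.univ) => weighted_sq_diff_nonneg hoff hp (fun j => W j k - P k) j i
  linarith

/-- Diffusive coupling and pinning of strength `s` dissipate the weighted energy at a rate
proportional to `s`. -/
theorem weighted_pinned_coupling_le {ι κ : Type*} [Fintype ι] [DecidableEq ι] [Fintype κ]
    {Ξ : Matrix ι ι ℝ} {p : ι → ℝ} {i₀ : ι} {σ lam : ℝ} (hlam : 0 < lam)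
    (hrow : ∀ j, ∑ k, Ξ j k = 0) (hp : ∀ j, 0 < p j)
    (hquad : ∀ x : ι → ℝ, ∑ j, p j * (x j * ∑ k, Ξ j k * x k) - p i₀ * σ * x i₀ ^ 2
        ≤ -lam * ∑ j, p j * x j ^ 2)
    {γ : κ → ℝ} {γm : ℝ} (hγm : 0 < γm) (hγ : ∀ k, γm ≤ γ k) {s : ℝ} (hs : 0 ≤ s)
    (W : ι → κ → ℝ) (P : κ → ℝ) :
    ∑ j, p j * ∑ k, 2 * ((W j k - P k) * (s * (∑ i, Ξ j i * (γ k * W i k))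
        + if j = i₀ then s * σ * (γ k * (P k - W i₀ k)) else 0))
      ≤ -(2 * γm * lam * s) * ∑ j, p j * ∑ k, (W j k - P k) ^ 2 := by
  have hsplit : ∑ j, p j * ∑ k, 2 * ((W j k - P k) * (s * (∑ i, Ξ j i * (γ k * W i k))
        + if j = i₀ then s * σ * (γ k * (P k - W i₀ k)) else 0))
      = ∑ k, 2 * s * γ k * (∑ j, p j * ((W j k - P k) * ∑ i, Ξ j i * (W i k - P k))
          - p i₀ * σ * (W i₀ k - P k) ^ 2) := by
    simp only [fun j k => coupling_eq_coupling_error hrow (γ k) (P k) (fun i => W i k) j]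
    simp only [Finset.mul_sum (s := (Finset.univ : Finset κ)) _ (p _)]
    rw [Finset.sum_comm]
    refine Finset.sum_congr rfl fun k _ => ?_
    have hpin : p i₀ * σ * (W i₀ k - P k) ^ 2
        = ∑ j, if j = i₀ then p j * σ * (W j k - P k) ^ 2 else 0 := by simp
    rw [hpin, ← Finset.sum_sub_distrib, Finset.mul_sum]
    refine Finset.sum_congr rfl fun j _ => ?_
    split_ifs with hj
    · subst hj
      ring
    · ring
  have hswap : ∑ j, p j * ∑ k, (W j k - P k) ^ 2 = ∑ k, ∑ j, p j * (W j k - P k) ^ 2 := by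
    simp only [Finset.mul_sum]
    rw [Finset.sum_comm]
  rw [hsplit, hswap, Finset.mul_sum]
  refine Finset.sum_le_sum fun k _ => ?_
  have hγk : 0 < γ k := hγm.trans_le (hγ k)
  have hS : 0 ≤ ∑ j, p j * (W j k - P k) ^ 2 :=
    Finset.sum_nonneg fun j _ => mul_nonneg (hp j).le (sq_nonneg _)
  have h1 := mul_le_mul_of_nonneg_left (hquad fun j => W j k - P k)
    (show 0 ≤ 2 * s * γ k by positivity)
  refine h1.trans ?_
  have h2 := mul_le_mul_of_nonneg_right (hγ k)
    (show 0 ≤ 2 * s * lam * ∑ j, p j * (W j k - P k) ^ 2 by positivity)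
  linarith

/-- Corollary 3: asymptotic complete synchronization of the
reaction-diffusion neural network with adaptive state coupling only, with
time-varying delays, under aperiodically intermittent pinning control of
node `1` (index `0`), when the delay bound `τ̄` is smaller than the infimum
`θ` of the control span widths. -/
theorem adaptive_state_coupled_network_synchronization (m n N : ℕ)
    (l : Fin (m + 1) → ℝ) (hl : ∀ r, 0 < l r)
    (Ω : Set (EuclideanSpace ℝ (Fin (m + 1))))
    (hΩ : Ω = {x : EuclideanSpace ℝ (Fin (m + 1)) | ∀ r, |x r| < l r})
    (D : Fin (n + 1) → Fin (m + 1) → ℝ) (hD : ∀ k r, 0 ≤ D k r)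
    (c : Fin (n + 1) → ℝ) (hc : ∀ k, 0 < c k)
    (A B : Matrix (Fin (n + 1)) (Fin (n + 1)) ℝ) (η : Fin (n + 1) → ℝ)
    (τb : ℝ) (hτb : 0 < τb)
    (τ : ℝ → ℝ) (hτ : ∀ t, τ t ∈ Icc 0 τb)
    (g h : (Fin (n + 1) → ℝ) → Fin (n + 1) → ℝ)
    (gs hs : ℝ) (hgs : 0 < gs) (hhs : 0 < hs)
    (hLipg : ∀ u v, Real.sqrt (∑ k, (g u k - g v k) ^ 2) ≤
      gs * Real.sqrt (∑ k, (u k - v k) ^ 2))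
    (hLiph : ∀ u v, Real.sqrt (∑ k, (h u k - h v k) ^ 2) ≤
      hs * Real.sqrt (∑ k, (u k - v k) ^ 2))
    (Ξ : Matrix (Fin (N + 1)) (Fin (N + 1)) ℝ)
    (hΞoff : ∀ j k, j ≠ k → 0 ≤ Ξ j k)
    (hΞrow : ∀ j, ∑ k, Ξ j k = 0)
    (hΞirr : ∀ S : Finset (Fin (N + 1)), S.Nonempty → S ≠ Finset.univ →
      ∃ j ∈ S, ∃ k, k ∉ S ∧ 0 < Ξ j k)
    (σ : ℝ) (hσ : 0 < σ)
    (γ1 : Fin (n + 1) → ℝ) (hγ1 : ∀ k, 0 < γ1 k)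
    (ts ss : ℕ → ℝ) (hts0 : ts 0 = 0)
    (hcs : ∀ i, ts i < ss i) (hrs : ∀ i, ss i < ts (i + 1))
    (htlim : Tendsto ts atTop atTop)
    (θ ω : ℝ) (hθ : 0 < θ) (hθω : θ < ω)
    (hinf : (⨅ i, (ss i - ts i)) = θ) (hsup : (⨆ i, (ts (i + 1) - ts i)) = ω)
    (hτθ : τb < θ)
    (π : ℝ → EuclideanSpace ℝ (Fin (m + 1)) → Fin (n + 1) → ℝ)
    (w : Fin (N + 1) → ℝ → EuclideanSpace ℝ (Fin (m + 1)) → Fin (n + 1) → ℝ)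
    -- regularity of the target trajectory and of the node states
    (hπC : ContinuousOn (fun q : ℝ × EuclideanSpace ℝ (Fin (m + 1)) => π q.1 q.2)
      (Ici (-τb) ×ˢ closure Ω))
    (hwC : ∀ j, ContinuousOn
      (fun q : ℝ × EuclideanSpace ℝ (Fin (m + 1)) => w j q.1 q.2)
      (Ici (-τb) ×ˢ closure Ω))
    (hπbd : ∀ t ∈ Ici (-τb), ∀ x ∈ frontier Ω, π t x = 0)
    (hwbd : ∀ j, ∀ t ∈ Ici (-τb), ∀ x ∈ frontier Ω, w j t x = 0)
    (hπx : ∀ t ∈ Ici (-τb), ContDiffOn ℝ 2 (π t) (closure Ω))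
    (hwx : ∀ j, ∀ t ∈ Ici (-τb), ContDiffOn ℝ 2 (w j t) (closure Ω))
    (hπx1 : ∀ (k : Fin (n + 1)) (r : Fin (m + 1)), ContinuousOn
      (fun q : ℝ × EuclideanSpace ℝ (Fin (m + 1)) => par (fun y => π q.1 y k) r q.2)
      (Ici (-τb) ×ˢ closure Ω))
    (hπx2 : ∀ (k : Fin (n + 1)) (r : Fin (m + 1)), ContinuousOn
      (fun q : ℝ × EuclideanSpace ℝ (Fin (m + 1)) => par2 (fun y => π q.1 y k) r q.2)
      (Ici (-τb) ×ˢ closure Ω))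
    (hwx1 : ∀ j (k : Fin (n + 1)) (r : Fin (m + 1)), ContinuousOn
      (fun q : ℝ × EuclideanSpace ℝ (Fin (m + 1)) => par (fun y => w j q.1 y k) r q.2)
      (Ici (-τb) ×ˢ closure Ω))
    (hwx2 : ∀ j (k : Fin (n + 1)) (r : Fin (m + 1)), ContinuousOn
      (fun q : ℝ × EuclideanSpace ℝ (Fin (m + 1)) => par2 (fun y => w j q.1 y k) r q.2)
      (Ici (-τb) ×ˢ closure Ω))
    -- jointly continuous time derivatives on (0,∞)
    (hwt : ∀ j, ∃ w' : ℝ → EuclideanSpace ℝ (Fin (m + 1)) → Fin (n + 1) → ℝ,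
      ContinuousOn (fun q : ℝ × EuclideanSpace ℝ (Fin (m + 1)) => w' q.1 q.2)
        (Ioi 0 ×ˢ closure Ω) ∧
      ∀ t ∈ Ioi (0 : ℝ), ∀ x ∈ closure Ω,
        HasDerivAt (fun s => w j s x) (w' t x) t)
    (hπt : ∃ π' : ℝ → EuclideanSpace ℝ (Fin (m + 1)) → Fin (n + 1) → ℝ,
      ContinuousOn (fun q : ℝ × EuclideanSpace ℝ (Fin (m + 1)) => π' q.1 q.2)
        (Ioi 0 ×ˢ closure Ω) ∧
      ∀ t ∈ Ioi (0 : ℝ), ∀ x ∈ closure Ω,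
        HasDerivAt (fun s => π s x) (π' t x) t)
    -- the adaptive aperiodically intermittent coupling strength
    (ψ : ℝ) (hψ : 0 < ψ)
    (Ψ : ℝ → ℝ) (hΨnn : ∀ t ≥ (0 : ℝ), 0 ≤ Ψ t) (hΨ0 : Ψ 0 = 0)
    (hΨrest : ∀ i, ∀ t ∈ Ioo (ss i) (ts (i + 1)), Ψ t = 0)
    (hΨjump : ∀ i, Ψ (ts (i + 1)) = Ψ (ss i))
    (hΨd : ∀ i, ∀ t ∈ Icc (ts i) (ss i),
      HasDerivWithinAt Ψ
        (ψ * sSup ((fun ς => ∑ j, ∫ x in Ω,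
          ∑ k, (w j (t + ς) x k - π (t + ς) x k) ^ 2) '' Icc (-τb) 0))
        (Icc (ts i) (ss i)) t)
    -- the target trajectory
    (hπeq : ∀ t > (0 : ℝ), ∀ x ∈ Ω,
      HasDerivAt (fun s => π s x) (drift D c A B η g h τ π t x) t)
    -- node `0` during the control spans (adaptively pinned)
    (hw0ctrl : ∀ i, ∀ t ∈ Icc (ts i) (ss i), 0 < t → ∀ x ∈ Ω,
      HasDerivAt (fun s => w 0 s x)
        (fun k => drift D c A B η g h τ (w 0) t x k
          + Ψ t * (∑ k', Ξ 0 k' * (γ1 k * w k' t x k))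
          + Ψ t * σ * (γ1 k * (π t x k - w 0 t x k))) t)
    -- nodes `j ≠ 0` during the control spans (adaptive coupling)
    (hwctrl : ∀ j, j ≠ 0 → ∀ i, ∀ t ∈ Icc (ts i) (ss i), 0 < t → ∀ x ∈ Ω,
      HasDerivAt (fun s => w j s x)
        (fun k => drift D c A B η g h τ (w j) t x k
          + Ψ t * (∑ k', Ξ j k' * (γ1 k * w k' t x k))) t)
    -- all nodes during the rest spans (coupling strength 1)
    (hwrest : ∀ j, ∀ i, ∀ t ∈ Ioo (ss i) (ts (i + 1)), ∀ x ∈ Ω,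
      HasDerivAt (fun s => w j s x)
        (fun k => drift D c A B η g h τ (w j) t x k
          + (∑ k', Ξ j k' * (γ1 k * w k' t x k))) t) :
    Tendsto (fun t => Real.sqrt (∑ j, ∫ x in Ω, ∑ k, (w j t x k - π t x k) ^ 2))
      atTop (nhds 0) := by
  classical
  have hopen : IsOpen Ω := hΩ ▸ isOpen_box l
  have hcomp : IsCompact (closure Ω) := hΩ ▸ isCompact_closure_box l
  obtain ⟨p, hp, hnull⟩ := exists_pos_left_null_vector hΞoff hΞrow hΞirr
  obtain ⟨lam, hlam, hquad⟩ :=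
    exists_pinned_quadratic_form_le 0 hΞoff hΞrow hΞirr hp hnull hσ
  obtain ⟨kγ, hkγ⟩ := Finite.exists_min γ1
  obtain ⟨jmin, hjmin⟩ := Finite.exists_min p
  obtain ⟨jmax, hjmax⟩ := Finite.exists_max p
  choose w' hw'C hw'd using hwt
  obtain ⟨π', hπ'C, hπ'd⟩ := hπt
  set C := (∑ k, ∑ q, |A k q|) * (1 + gs ^ 2) + ∑ k, ∑ q, |B k q| with hC
  set K := (∑ k, ∑ q, |B k q|) * hs ^ 2 with hK
  have hCnn : 0 ≤ C := by positivity
  have hKnn : 0 ≤ K := by positivity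
  set I : Fin (N + 1) → ℝ → ℝ := fun j t =>
    ∫ x in Ω, ∑ k, (w j t x k - π t x k) ^ 2 with hI
  have hInn : ∀ j t, 0 ≤ I j t := fun j t =>
    integral_nonneg fun x => Finset.sum_nonneg fun k _ => sq_nonneg _
  set V : ℝ → ℝ := fun t => ∑ j, p j * I j t with hV
  set V' : ℝ → ℝ := fun t => ∑ j, p j *
    ∫ x in Ω, ∑ k, 2 * ((w j t x k - π t x k) * (w' j t x k - π' t x k)) with hV'
  have hIcont : ∀ j, ContinuousOn (I j) (Ici (-τb)) := fun j =>
    continuousOn_setIntegral_of_isCompact_closure hopen.measurableSet hcomp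
      (continuousOn_finsetSum _ fun k _ =>
        ((continuousOn_pi.1 (hwC j) k).sub (continuousOn_pi.1 hπC k)).pow 2)
  have hVcont : ContinuousOn V (Ici (-τb)) :=
    continuousOn_finsetSum _ fun j _ => continuousOn_const.mul (hIcont j)
  have hmem : ∀ t > (0 : ℝ), t ∈ Ici (-τb) := fun t ht => by
    simp only [mem_Ici]
    linarith
  have hpos_sub : Ioi (0 : ℝ) ×ˢ closure Ω ⊆ Ici (-τb) ×ˢ closure Ω :=
    prod_mono (fun t ht => hmem t ht) subset_rfl
  have hVd : ∀ t > 0, HasDerivAt V (V' t) t := by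
    intro t ht
    refine HasDerivAt.fun_sum fun j _ => HasDerivAt.const_mul (p j) ?_
    refine hasDerivAt_setIntegral_of_isCompact_closure (a := 0) hopen.measurableSet hcomp
      (φ' := fun t x => ∑ k, 2 * ((w j t x k - π t x k) * (w' j t x k - π' t x k)))
      ?_ ?_ ?_ ht
    · intro s hs
      exact continuousOn_finsetSum _ fun k _ =>
        ((continuousOn_pi.1 (continuousOn_slice (hwC j) (hmem s hs)) k).sub
          (continuousOn_pi.1 (continuousOn_slice hπC (hmem s hs)) k)).pow 2
    · exact continuousOn_finsetSum _ fun k _ => continuousOn_const.mul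
        (((continuousOn_pi.1 ((hwC j).mono hpos_sub) k).sub
          (continuousOn_pi.1 (hπC.mono hpos_sub) k)).mul
          ((continuousOn_pi.1 (hw'C j) k).sub (continuousOn_pi.1 hπ'C k)))
    · intro s hs x hx
      refine HasDerivAt.fun_sum fun k _ => ?_
      have h1 := hasDerivAt_pi.1 (hw'd j s hs x (subset_closure hx)) k
      have h2 := hasDerivAt_pi.1 (hπ'd s hs x (subset_closure hx)) k
      exact ((h1.fun_sub h2).fun_pow 2).congr_deriv (by simp; ring)
  have hintegrableΩ : ∀ {φ : EuclideanSpace ℝ (Fin (m + 1)) → ℝ}, ContinuousOn φ (closure Ω) →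
      IntegrableOn φ Ω := fun hφ => (hφ.integrableOn_compact hcomp).mono_set subset_closure
  have henergy : ∀ t > 0, ∀ (R : Fin (N + 1) → EuclideanSpace ℝ (Fin (m + 1)) → Fin (n + 1) → ℝ)
      (μ : ℝ), (∀ j, ContinuousOn (R j) (closure Ω)) →
      (∀ j, ∀ x ∈ Ω, w' j t x = fun k => drift D c A B η g h τ (w j) t x k + R j x k) →
      (∀ x ∈ Ω, ∑ j, p j * ∑ k, 2 * ((w j t x k - π t x k) * R j x k)
        ≤ -μ * ∑ j, p j * ∑ k, (w j t x k - π t x k) ^ 2) →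
      V' t ≤ (C - μ) * V t + K * V (t - τ t) := by
    intro t ht R μ hRc hReq hRle
    have htI := hmem t ht
    have htτ : t - τ t ∈ Ici (-τb) := by
      simp only [mem_Ici]
      linarith [(hτ t).2]
    have hnode : ∀ j, ∫ x in Ω, ∑ k, 2 * ((w j t x k - π t x k) * (w' j t x k - π' t x k))
        ≤ C * I j t + K * I j (t - τ t)
          + ∫ x in Ω, ∑ k, 2 * ((w j t x k - π t x k) * R j x k) := fun j =>
      node_energy_le hl hΩ hD hc A B η hgs hhs hLipg hLiph τ (hwx j t htI) (hπx t htI)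
        (fun x hx => (hwbd j t htI x hx).trans (hπbd t htI x hx).symm)
        (fun k r => continuousOn_slice (φ := fun s => par (fun y => w j s y k) r) (hwx1 j k r) htI)
        (fun k r => continuousOn_slice (φ := fun s => par (fun y => π s y k) r) (hπx1 k r) htI)
        (fun k r => continuousOn_slice (φ := fun s => par2 (fun y => w j s y k) r) (hwx2 j k r) htI)
        (fun k r => continuousOn_slice (φ := fun s => par2 (fun y => π s y k) r) (hπx2 k r) htI)
        (continuousOn_slice (hwC j) htτ) (continuousOn_slice hπC htτ)
        (continuousOn_slice (hw'C j) ht) (continuousOn_slice hπ'C ht) (hRc j)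
        (fun x hx k => congrFun (hReq j x hx) k)
        (fun x hx k => congrFun
          ((hπ'd t ht x (subset_closure hx)).unique (hπeq t ht x hx)) k)
    have herr : ∀ j k, ContinuousOn (fun x => w j t x k - π t x k) (closure Ω) := fun j k =>
      (continuousOn_pi.1 (continuousOn_slice (hwC j) htI) k).sub
        (continuousOn_pi.1 (continuousOn_slice hπC htI) k)
    have hintR : ∀ j, IntegrableOn
        (fun x => p j * ∑ k, 2 * ((w j t x k - π t x k) * R j x k)) Ω := fun j =>
      hintegrableΩ (continuousOn_const.mul (continuousOn_finsetSum _ fun k _ =>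
        continuousOn_const.mul ((herr j k).mul (continuousOn_pi.1 (hRc j) k))))
    have hintE : ∀ j, IntegrableOn (fun x => p j * ∑ k, (w j t x k - π t x k) ^ 2) Ω := fun j =>
      hintegrableΩ (continuousOn_const.mul (continuousOn_finsetSum _ fun k _ => (herr j k).pow 2))
    have hcoup : ∑ j, p j * (∫ x in Ω, ∑ k, 2 * ((w j t x k - π t x k) * R j x k))
        ≤ -μ * V t := by
      have h1 := setIntegral_mono_on (integrable_finsetSum Finset.univ fun j _ => hintR j)
        ((integrable_finsetSum Finset.univ fun j _ => hintE j).const_mul (-μ))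
        hopen.measurableSet hRle
      rw [integral_const_mul, integral_finsetSum _ fun j _ => hintR j,
        integral_finsetSum _ fun j _ => hintE j] at h1
      simpa only [integral_const_mul] using h1
    have hsum := Finset.sum_le_sum fun j (_ : j ∈ Finset.univ) =>
      mul_le_mul_of_nonneg_left (hnode j) (hp j).le
    have hexp : ∑ j, p j * (C * I j t + K * I j (t - τ t)
          + ∫ x in Ω, ∑ k, 2 * ((w j t x k - π t x k) * R j x k))
        = C * V t + K * V (t - τ t)
          + ∑ j, p j * (∫ x in Ω, ∑ k, 2 * ((w j t x k - π t x k) * R j x k)) := by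
      simp only [hV, Finset.mul_sum, ← Finset.sum_add_distrib]
      exact Finset.sum_congr rfl fun j _ => by ring
    rw [hexp] at hsum
    have hV't : V' t ≤ C * V t + K * V (t - τ t)
        + ∑ j, p j * (∫ x in Ω, ∑ k, 2 * ((w j t x k - π t x k) * R j x k)) := hsum
    linarith
  have hcoupc : ∀ t > 0, ∀ j k, ContinuousOn
      (fun x => ∑ i, Ξ j i * (γ1 k * w i t x k)) (closure Ω) := fun t ht j k =>
    continuousOn_finsetSum _ fun i _ => continuousOn_const.mul (continuousOn_const.mul
      (continuousOn_pi.1 (continuousOn_slice (hwC i) (hmem t ht)) k))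
  have hctrl : ∀ i, ∀ t ∈ Icc (ts i) (ss i), 0 < t →
      V' t ≤ (C - 2 * γ1 kγ * lam * Ψ t) * V t + K * V (t - τ t) := by
    intro i t hti ht
    refine henergy t ht (fun j x k => Ψ t * (∑ i, Ξ j i * (γ1 k * w i t x k))
      + if j = 0 then Ψ t * σ * (γ1 k * (π t x k - w 0 t x k)) else 0) _ ?_ ?_ ?_
    · intro j
      refine continuousOn_pi.2 fun k => (continuousOn_const.mul (hcoupc t ht j k)).add ?_
      by_cases hj : j = 0
      · simp only [hj, if_true]
        exact continuousOn_const.mul (continuousOn_const.mul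
          ((continuousOn_pi.1 (continuousOn_slice hπC (hmem t ht)) k).sub
            (continuousOn_pi.1 (continuousOn_slice (hwC 0) (hmem t ht)) k)))
      · simp only [hj, if_false]
        exact continuousOn_const
    · intro j x hx
      have hd := hw'd j t ht x (subset_closure hx)
      by_cases hj : j = 0
      · subst hj
        rw [hd.unique (hw0ctrl i t hti ht x hx)]
        simp only [if_true, add_assoc]
      · rw [hd.unique (hwctrl j hj i t hti ht x hx)]
        simp only [hj, if_false, add_zero]
    · intro x _
      exact weighted_pinned_coupling_le hlam hΞrow hp hquad (hγ1 kγ) hkγ (hΨnn t ht.le)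
        (fun j => w j t x) (π t x)
  have hrest : ∀ i, ∀ t ∈ Ioo (ss i) (ts (i + 1)), V' t ≤ C * V t + K * V (t - τ t) := by
    intro i t hti
    have htsmono : Monotone ts :=
      monotone_nat_of_le_succ fun i => ((hcs i).trans (hrs i)).le
    have ht : 0 < t := by
      have := htsmono (Nat.zero_le i)
      linarith [hti.1, hcs i]
    have h := henergy t ht (fun j x k => ∑ i, Ξ j i * (γ1 k * w i t x k)) 0
      (fun j => continuousOn_pi.2 fun k => hcoupc t ht j k)
      (fun j x hx =>
        (hw'd j t ht x (subset_closure hx)).unique (hwrest j i t hti x hx))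
      (fun x _ => by
        rw [neg_zero, zero_mul]
        exact weighted_coupling_nonpos hΞoff hΞrow hp hnull hγ1 (fun j => w j t x) (π t x))
    rwa [sub_zero] at h
  have hspan : ∀ i, θ ≤ ss i - ts i := fun i => hinf ▸ ciInf_le
    ⟨0, by rintro _ ⟨i, rfl⟩; exact (sub_pos.2 (hcs i)).le⟩ i
  have hbdd : BddAbove (range fun i => ts (i + 1) - ts i) := by
    by_contra hnot
    rw [Real.iSup_of_not_bddAbove hnot] at hsup
    linarith
  have hperiod : ∀ i, ts (i + 1) - ts i ≤ ω := fun i => hsup ▸ le_ciSup hbdd i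
  have hγlam : 0 < 2 * γ1 kγ * lam := mul_pos (mul_pos two_pos (hγ1 kγ)) hlam
  have hQV : ∀ t, p jmin * ∑ j, I j t ≤ V t := fun t => by
    rw [Finset.mul_sum]
    exact Finset.sum_le_sum fun j _ => mul_le_mul_of_nonneg_right (hjmin j) (hInn j t)
  have hVQ : ∀ t, V t ≤ p jmax * ∑ j, I j t := fun t => by
    rw [Finset.mul_sum]
    exact Finset.sum_le_sum fun j _ => mul_le_mul_of_nonneg_right (hjmax j) (hInn j t)
  have hQnn : ∀ t, 0 ≤ ∑ j, I j t := fun t => Finset.sum_nonneg fun j _ => hInn j t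
  have hVlim : Tendsto V atTop (nhds 0) :=
    tendsto_zero_of_adaptive_intermittent_gain hτ hts0 hcs hrs htlim hτθ hspan hperiod hCnn hKnn
      hγlam (hp jmax) (hp jmin) hψ hVcont hQnn hQV hVQ hVd hΨnn hctrl hrest hΨjump hΨd
  have hQlim : Tendsto (fun t => ∑ j, I j t) atTop (nhds 0) := by
    refine squeeze_zero hQnn (fun t => (le_div_iff₀' (hp jmin)).2 (hQV t)) ?_
    simpa using hVlim.div_const (p jmin)
  simpa using hQlim.sqrt
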